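/- If α < α_th, then C_H(A, αA) ≤ sup_p inf_{μ>0} { log V_H − D(p‖q) + Σ_{U∈𝒰} p_U Σ_{ℓ=1}^{nr} log(σ_{U,ℓ} + (A/√(2πe))·(1−e^{−μ})/μ) + (μ/(A√(2π)))·Σ_{U∈𝒰} p_U Σ_{ℓ=1}^{nr} σ_{U,ℓ}·(1 − e^{−A²/(2σ_{U,ℓ}²)}) + μ·(α − Σ_{U∈𝒰} p_U s_U) }, where the supremum is over all probability vectors p on 𝒰 satisfying Σ_{U∈𝒰} p_U s_U ≤ α. -/

import Mathlib

open MeasureTheory ProbabilityTheory Matrix Filter Topology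
open scoped ENNReal NNReal BigOperators

noncomputable section

namespace MimoOptical

variable {nt nr : ℕ}

/-- The law of a standard Gaussian vector `Z ~ N(0, I_n)` on `ℝ^n`. -/
def stdGaussian (n : ℕ) : Measure (Fin n → ℝ) :=
  Measure.pi fun _ => gaussianReal 0 1

/-- Real-valued Kullback–Leibler divergence `∫ log (dμ/dν) dμ`
(with junk value if not absolutely continuous or not integrable). -/
def klDivR {Ω : Type*} [MeasurableSpace Ω] (μ ν : Measure Ω) : ℝ :=
  ∫ ω, Real.log (μ.rnDeriv ν ω).toReal ∂μ

/-- Mutual information of a joint law on a product space: the KL divergence between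
the joint law and the product of its marginals. -/
def mutualInfoJoint {β γ : Type*} [MeasurableSpace β] [MeasurableSpace γ]
    (π : Measure (β × γ)) : ℝ :=
  klDivR π ((π.map Prod.fst).prod (π.map Prod.snd))

/-- Joint law of `(X, H X + Z)` where `X ~ μ` and `Z ~ N(0, I_nr)` is independent of `X`. -/
def jointLaw (H : Matrix (Fin nr) (Fin nt) ℝ) (μ : Measure (Fin nt → ℝ)) :
    Measure ((Fin nt → ℝ) × (Fin nr → ℝ)) :=
  (μ.prod (stdGaussian nr)).map (fun p => (p.1, H.mulVec p.1 + p.2))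

/-- An admissible input distribution: a probability measure on `[0, A]^nt`
with average power `E[‖X‖₁] ≤ avg`. -/
def Admissible (nt : ℕ) (A avg : ℝ) (μ : Measure (Fin nt → ℝ)) : Prop :=
  IsProbabilityMeasure μ ∧ (∀ᵐ x ∂μ, ∀ k, x k ∈ Set.Icc (0 : ℝ) A) ∧
    (∫ x, ∑ k, |x k| ∂μ) ≤ avg

/-- Capacity of the MIMO optical intensity channel with peak power `A` and
average power `avg`. -/
def capacity (H : Matrix (Fin nr) (Fin nt) ℝ) (A avg : ℝ) : ℝ :=
  sSup { c | ∃ μ : Measure (Fin nt → ℝ),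
    Admissible nt A avg μ ∧ c = mutualInfoJoint (jointLaw H μ) }

/-- The zonotope `R(M) = { M λ : λ ∈ [0,A]^k }`. -/
def zonotope {n k : ℕ} (M : Matrix (Fin n) (Fin k) ℝ) (A : ℝ) : Set (Fin n → ℝ) :=
  { x | ∃ lam : Fin k → ℝ, (∀ i, lam i ∈ Set.Icc 0 A) ∧ x = M.mulVec lam }

/-- The collection `𝒰` of `nr`-element subsets of columns that are linearly independent. -/
def goodSets (H : Matrix (Fin nr) (Fin nt) ℝ) : Set (Finset (Fin nt)) :=
  { U | U.card = nr ∧ LinearIndependent ℝ (fun j : {x // x ∈ U} => fun i => H i j.1) }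

/-- The square matrix `H_U` whose columns are the columns of `H` indexed by `U`
(junk value, the identity, if `U.card ≠ nr`). -/
def HU (H : Matrix (Fin nr) (Fin nt) ℝ) (U : Finset (Fin nt)) :
    Matrix (Fin nr) (Fin nr) ℝ :=
  if h : U.card = nr then H.submatrix id (fun i => U.orderEmbOfFin h i) else 1

/-- `a_{U,j} = 1ᵀ H_U⁻¹ h_j`. -/
def aUj (H : Matrix (Fin nr) (Fin nt) ℝ) (U : Finset (Fin nt)) (j : Fin nt) : ℝ :=
  ∑ i, ((HU H U)⁻¹).mulVec (fun r => H r j) i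

/-- `g_{U,j} = 1` if `a_{U,j} > 1` and `0` otherwise. -/
def gUj (H : Matrix (Fin nr) (Fin nt) ℝ) (U : Finset (Fin nt)) (j : Fin nt) : ℝ :=
  if 1 < aUj H U j then 1 else 0

/-- `s_U = Σ_{j ∈ Uᶜ} g_{U,j}`. -/
def sU (H : Matrix (Fin nr) (Fin nt) ℝ) (U : Finset (Fin nt)) : ℝ :=
  ∑ j ∈ Uᶜ, gUj H U j

/-- `v_U = A Σ_{j ∈ Uᶜ} g_{U,j} h_j`. -/
def vU (H : Matrix (Fin nr) (Fin nt) ℝ) (A : ℝ) (U : Finset (Fin nt)) : Fin nr → ℝ :=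
  fun r => A * ∑ j ∈ Uᶜ, gUj H U j * H r j

/-- The parallelepiped `D_U = R(H_U)`. -/
def DU (H : Matrix (Fin nr) (Fin nt) ℝ) (A : ℝ) (U : Finset (Fin nt)) :
    Set (Fin nr → ℝ) :=
  zonotope (HU H U) A

/-- The shifted parallelepiped `v_U + D_U`. -/
def cell (H : Matrix (Fin nr) (Fin nt) ℝ) (A : ℝ) (U : Finset (Fin nt)) :
    Set (Fin nr → ℝ) :=
  (fun d => vU H A U + d) '' DU H A U

/-- `V_H = Σ_{U ∈ 𝒰} |det H_U|`. -/
def VH (H : Matrix (Fin nr) (Fin nt) ℝ) : ℝ :=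
  ∑ᶠ U ∈ goodSets H, |(HU H U).det|

/-- `q_U = |det H_U| / V_H`. -/
def qU (H : Matrix (Fin nr) (Fin nt) ℝ) (U : Finset (Fin nt)) : ℝ :=
  |(HU H U).det| / VH H

/-- `α_th = nr/2 + Σ_{U ∈ 𝒰} s_U q_U`. -/
def alphaTh (H : Matrix (Fin nr) (Fin nt) ℝ) : ℝ :=
  (nr : ℝ) / 2 + ∑ᶠ U ∈ goodSets H, sU H U * qU H U

/-- A probability vector on `𝒰`. -/
def ProbVec (H : Matrix (Fin nr) (Fin nt) ℝ) (p : Finset (Fin nt) → ℝ) : Prop :=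
  (∀ U, 0 ≤ p U) ∧ (∀ U, U ∉ goodSets H → p U = 0) ∧ (∑ᶠ U ∈ goodSets H, p U) = 1

/-- Kullback–Leibler divergence `D(p‖q)` between probability vectors on `𝒰`. -/
def Dkl (H : Matrix (Fin nr) (Fin nt) ℝ) (p q : Finset (Fin nt) → ℝ) : ℝ :=
  ∑ᶠ U ∈ goodSets H, p U * Real.log (p U / q U)

/-- `σ_{U,ℓ}`: square root of the `ℓ`-th diagonal entry of `H_U⁻¹ (H_U⁻¹)ᵀ`. -/
def sigmaUl (H : Matrix (Fin nr) (Fin nt) ℝ) (U : Finset (Fin nt)) (ℓ : Fin nr) : ℝ :=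
  Real.sqrt ((((HU H U)⁻¹) * ((HU H U)⁻¹)ᵀ) ℓ ℓ)

/-- The trace of the covariance matrix of `X̄ = H X` when `X ~ μ`. -/
def traceCov (H : Matrix (Fin nr) (Fin nt) ℝ) (μ : Measure (Fin nt → ℝ)) : ℝ :=
  ∑ i, ((∫ x, (H.mulVec x i) ^ 2 ∂μ) - (∫ x, H.mulVec x i ∂μ) ^ 2)

/-- The Gaussian Q-function. -/
def Qf (x : ℝ) : ℝ :=
  ∫ t in Set.Ioi x, Real.exp (-t ^ 2 / 2) / Real.sqrt (2 * Real.pi)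

/-- The high-SNR penalty `ν` due to the average-power constraint. -/
def nuVal (H : Matrix (Fin nr) (Fin nt) ℝ) (α : ℝ) : ℝ :=
  sSup { y | ∃ lam mu : ℝ,
    lam ∈ Set.Ioo (max 0 ((nr : ℝ) / 2 + α - alphaTh H)) (min ((nr : ℝ) / 2) α) ∧
    0 < mu ∧
    1 / mu - Real.exp (-mu) / (1 - Real.exp (-mu)) = lam / (nr : ℝ) ∧
    y = (nr : ℝ) * (1 - Real.log (mu / (1 - Real.exp (-mu)))
          - mu * Real.exp (-mu) / (1 - Real.exp (-mu)))
        - sInf { d | ∃ p : Finset (Fin nt) → ℝ, ProbVec H p ∧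
            (∑ᶠ U ∈ goodSets H, p U * sU H U) = α - lam ∧ d = Dkl H p (qU H) } }

end MimoOptical

namespace MimoAux

/-- piecewise-linear function along a line -/
def lineG {ι : Type*} [Fintype ι] (A : ℝ) (e f : ι → ℝ) (β t : ℝ) : ℝ :=
  A * ∑ j, max (e j + t * f j) 0 - t * β

def slopeM {ι : Type*} [Fintype ι] (A : ℝ) (e f : ι → ℝ) (β : ℝ) : ℝ :=
  A * ∑ j, (if 0 < e j then f j else 0) - β

lemma lineG_eq {ι : Type*} [Fintype ι] (A : ℝ) (e f : ι → ℝ) (β t : ℝ)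
    (h0 : ∀ j, e j = 0 → f j = 0) (hp : ∀ j, 0 < e j → 0 ≤ e j + t * f j)
    (hn : ∀ j, e j < 0 → e j + t * f j ≤ 0) :
    lineG A e f β t = lineG A e f β 0 + t * slopeM A e f β := by
  have key : ∀ j, max (e j + t * f j) 0 = max (e j + 0 * f j) 0
      + t * (if 0 < e j then f j else 0) := by
    intro j
    rcases lt_trichotomy (e j) 0 with h | h | h
    · rw [max_eq_right (hn j h), if_neg (by linarith), max_eq_right (by linarith)]; ring
    · simp [h, h0 j h]
    · rw [max_eq_left (hp j h), if_pos h, max_eq_left (by linarith)]; ring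
  unfold lineG slopeM
  simp_rw [key, Finset.sum_add_distrib, ← Finset.mul_sum]
  ring

lemma lineG_half {ι : Type*} [Fintype ι] (A : ℝ) (e f : ι → ℝ) (β : ℝ)
    (h0 : ∀ j, e j = 0 → f j = 0) (hm : slopeM A e f β ≤ 0)
    (hj : ∃ j, f j ≠ 0 ∧ 0 < - e j / f j) :
    ∃ t, lineG A e f β t ≤ lineG A e f β 0 ∧ ∃ j, f j ≠ 0 ∧ e j + t * f j = 0 := by
  classical
  set S : Finset ι := Finset.univ.filter (fun j => f j ≠ 0 ∧ 0 < - e j / f j) with hS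
  have hSne : S.Nonempty := by
    obtain ⟨j, hj⟩ := hj
    exact ⟨j, by simp [hS]; exact hj⟩
  obtain ⟨j0, hj0S, hmin⟩ := S.exists_min_image (fun j => - e j / f j) hSne
  have hj0 : f j0 ≠ 0 ∧ 0 < - e j0 / f j0 := by simpa [hS] using hj0S
  refine ⟨- e j0 / f j0, ?_, j0, hj0.1, by field_simp [hj0.1]; ring⟩
  have htpos := hj0.2
  generalize - e j0 / f j0 = t at *
  rw [lineG_eq A e f β t h0]
  · nlinarith
  · intro j hjp
    by_contra hcon
    push Not at hcon
    have hf : f j < 0 := by nlinarith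
    have h1 : 0 < - e j / f j := by
      rw [lt_div_iff_of_neg hf]; linarith
    have h2 := hmin j (by simp [hS]; exact ⟨hf.ne, h1⟩)
    rw [le_div_iff_of_neg hf] at h2
    linarith
  · intro j hjp
    by_contra hcon
    push Not at hcon
    have hf : 0 < f j := by nlinarith
    have h1 : 0 < - e j / f j := by
      rw [lt_div_iff₀ hf]; linarith
    have h2 := hmin j (by simp [hS]; exact ⟨hf.ne', h1⟩)
    rw [le_div_iff₀ hf] at h2
    linarith

lemma lineG_neg {ι : Type*} [Fintype ι] (A : ℝ) (e f : ι → ℝ) (β t : ℝ) :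
    lineG A e (fun j => - f j) (-β) t = lineG A e f β (-t) := by
  simp [lineG]

lemma slopeM_neg {ι : Type*} [Fintype ι] (A : ℝ) (e f : ι → ℝ) (β : ℝ) :
    slopeM A e (fun j => - f j) (-β) = - slopeM A e f β := by
  have : ∀ j, (if 0 < e j then - f j else 0) = - (if 0 < e j then f j else 0) := by
    intro j; split_ifs <;> simp
  simp only [slopeM, this, Finset.sum_neg_distrib]
  ring

lemma lineG_neg_case {ι : Type*} [Fintype ι] (A : ℝ) (e f : ι → ℝ) (β B : ℝ)
    (h0 : ∀ j, e j = 0 → f j = 0) (hm : slopeM A e f β < 0)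
    (hB : ∀ t, B ≤ lineG A e f β t) :
    ∃ j, f j ≠ 0 ∧ 0 < - e j / f j := by
  by_contra hcon
  push Not at hcon
  have hlin : ∀ t, 0 ≤ t → lineG A e f β t = lineG A e f β 0 + t * slopeM A e f β := by
    intro t ht
    apply lineG_eq A e f β t h0
    · intro j hj
      by_contra h
      push Not at h
      have hf : f j < 0 := by nlinarith
      have := hcon j hf.ne
      rw [div_le_iff_of_neg hf] at this
      linarith
    · intro j hj
      by_contra h
      push Not at h
      have hf : 0 < f j := by nlinarith
      have := hcon j hf.ne'
      rw [div_le_iff₀ hf] at this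
      linarith
  set m := slopeM A e f β
  have hb0 := hB 0
  set t := (lineG A e f β 0 - B + 1) / (-m) with ht
  have htm : t * m = - (lineG A e f β 0 - B + 1) := by
    rw [ht]; field_simp [hm.ne]
  have ht0 : 0 ≤ t := by
    apply div_nonneg <;> linarith
  have := hB t
  rw [hlin t ht0, htm] at this
  linarith

lemma lineG_main {ι : Type*} [Fintype ι] (A : ℝ) (e f : ι → ℝ) (β B : ℝ)
    (h0 : ∀ j, e j = 0 → f j = 0) (hB : ∀ t, B ≤ lineG A e f β t)
    (hj : ∃ j, f j ≠ 0) :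
    ∃ t, lineG A e f β t ≤ lineG A e f β 0 ∧ ∃ j, f j ≠ 0 ∧ e j + t * f j = 0 := by
  have back : (∃ t, lineG A e (fun j => - f j) (-β) t ≤ lineG A e (fun j => - f j) (-β) 0 ∧
      ∃ j, - f j ≠ 0 ∧ e j + t * (- f j) = 0) →
      ∃ t, lineG A e f β t ≤ lineG A e f β 0 ∧ ∃ j, f j ≠ 0 ∧ e j + t * f j = 0 := by
    rintro ⟨t, ht, j, hj1, hj2⟩
    rw [lineG_neg, lineG_neg, neg_zero] at ht
    exact ⟨-t, ht, j, by simpa using hj1, by linarith⟩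
  have h0' : ∀ j, e j = 0 → - f j = 0 := by
    intro j hj; simp [h0 j hj]
  rcases lt_trichotomy (slopeM A e f β) 0 with hm | hm | hm
  · exact lineG_half A e f β h0 hm.le (lineG_neg_case A e f β B h0 hm hB)
  · obtain ⟨j, hj⟩ := hj
    have hej : e j ≠ 0 := fun h => hj (h0 j h)
    rcases lt_or_gt_of_ne (div_ne_zero (neg_ne_zero.mpr hej) hj) with h | h
    · apply back
      apply lineG_half A e _ _ h0' (by rw [slopeM_neg, hm]; simp)
      refine ⟨j, by simpa using hj, ?_⟩
      rw [div_neg]; linarith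
    · exact lineG_half A e f β h0 hm.le ⟨j, hj, h⟩
  · apply back
    have hm' : slopeM A e (fun j => - f j) (-β) < 0 := by rw [slopeM_neg]; linarith
    apply lineG_half A e _ _ h0' hm'.le
    apply lineG_neg_case A e _ _ B h0' hm'
    intro t; rw [lineG_neg]; exact hB _

/-- dual objective -/
def dualF {nt nr : ℕ} (H : Matrix (Fin nr) (Fin nt) ℝ) (A : ℝ) (b : Fin nr → ℝ)
    (c : Fin nr → ℝ) : ℝ :=
  A * ∑ j, max ((c ᵥ* H) j - 1) 0 - c ⬝ᵥ b

lemma dualF_line {nt nr : ℕ} (H : Matrix (Fin nr) (Fin nt) ℝ) (A : ℝ) (b c d : Fin nr → ℝ)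
    (t : ℝ) : dualF H A b (c + t • d) =
      lineG A (fun j => (c ᵥ* H) j - 1) (fun j => (d ᵥ* H) j) (d ⬝ᵥ b) t - c ⬝ᵥ b := by
  have : ∀ j, (c ᵥ* H) j + t * (d ᵥ* H) j - 1 = (c ᵥ* H) j - 1 + t * (d ᵥ* H) j := by
    intro j; ring
  simp only [dualF, lineG, Matrix.add_vecMul, Matrix.smul_vecMul, Pi.add_apply, Pi.smul_apply,
    smul_eq_mul, add_dotProduct, smul_dotProduct, this]
  ring

lemma dualF_lower {nt nr : ℕ} (H : Matrix (Fin nr) (Fin nt) ℝ) (A : ℝ)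
    (x : Fin nt → ℝ) (hx : ∀ k, x k ∈ Set.Icc 0 A) (c : Fin nr → ℝ) :
    - ∑ k, x k ≤ dualF H A (H *ᵥ x) c := by
  have h1 : c ⬝ᵥ (H *ᵥ x) = ∑ j, (c ᵥ* H) j * x j := by
    rw [dotProduct_mulVec]; rfl
  rw [dualF, h1, Finset.mul_sum, ← Finset.sum_sub_distrib, ← Finset.sum_neg_distrib]
  apply Finset.sum_le_sum
  intro j _
  obtain ⟨h0, hA⟩ := hx j
  generalize (c ᵥ* H) j = a
  rcases le_total (a - 1) 0 with h | h
  · rw [max_eq_right h]; nlinarith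
  · rw [max_eq_left h]; nlinarith

/-- If the rows annihilate: a full row rank matrix has trivial left kernel. -/
lemma vecMul_ne {nt nr : ℕ} (H : Matrix (Fin nr) (Fin nt) ℝ) (hrank : H.rank = nr)
    (d : Fin nr → ℝ) (hd : d ≠ 0) : ∃ j, (d ᵥ* H) j ≠ 0 := by
  by_contra hcon
  push Not at hcon
  have hli : LinearIndependent ℝ H.row := by
    rw [linearIndependent_iff_card_eq_finrank_span, Set.finrank, ← Matrix.rank_eq_finrank_span_row, hrank]
    simp
  apply hd
  have := Matrix.vecMul_injective_iff.mpr hli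
  apply this
  ext j
  simp [hcon j]

/-- walk to a vertex -/
lemma exists_vertex {nt nr : ℕ} (H : Matrix (Fin nr) (Fin nt) ℝ) (hrank : H.rank = nr) (A : ℝ)
    (x : Fin nt → ℝ) (hx : ∀ k, x k ∈ Set.Icc 0 A) (n : ℕ) :
    ∀ c : Fin nr → ℝ, (Finset.univ.filter (fun j => (c ᵥ* H) j ≠ 1)).card = n →
    ∃ c', dualF H A (H *ᵥ x) c' ≤ dualF H A (H *ᵥ x) c ∧
      ∀ d : Fin nr → ℝ, (∀ j, (c' ᵥ* H) j = 1 → (d ᵥ* H) j = 0) → d = 0 := by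
  induction n using Nat.strong_induction_on with
  | _ n ih =>
    intro c hc
    by_cases hT : ∀ d : Fin nr → ℝ, (∀ j, (c ᵥ* H) j = 1 → (d ᵥ* H) j = 0) → d = 0
    · exact ⟨c, le_rfl, hT⟩
    push Not at hT
    obtain ⟨d, hd, hd0⟩ := hT
    obtain ⟨t, ht, j, hfj, hj⟩ := lineG_main A (fun j => (c ᵥ* H) j - 1) (fun j => (d ᵥ* H) j)
      (d ⬝ᵥ (H *ᵥ x)) (- ∑ k, x k + c ⬝ᵥ (H *ᵥ x)) (fun j hj => hd j (by linarith))
      (fun t => by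
        have := dualF_lower H A x hx (c + t • d)
        rw [dualF_line] at this
        linarith) (vecMul_ne H hrank d hd0)
    have hF : dualF H A (H *ᵥ x) (c + t • d) ≤ dualF H A (H *ᵥ x) c := by
      have h1 := dualF_line H A (H *ᵥ x) c d t
      have h2 := dualF_line H A (H *ᵥ x) c d 0
      rw [zero_smul, add_zero] at h2
      rw [h1, h2]; linarith
    have hval : ∀ k, ((c + t • d) ᵥ* H) k = (c ᵥ* H) k + t * (d ᵥ* H) k := by
      intro k; simp [Matrix.add_vecMul, Matrix.smul_vecMul]
    have hlt : (Finset.univ.filter (fun j => ((c + t • d) ᵥ* H) j ≠ 1)).card < n := by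
      rw [← hc]
      apply Finset.card_lt_card
      rw [Finset.ssubset_iff_of_subset]
      · refine ⟨j, ?_, ?_⟩
        · simp only [Finset.mem_filter, Finset.mem_univ, true_and]
          intro h; exact hfj (hd j h)
        · simp only [Finset.mem_filter, Finset.mem_univ, true_and, not_not, hval]
          linarith
      · intro k
        simp only [Finset.mem_filter, Finset.mem_univ, true_and, hval]
        intro hk h
        rw [h, hd k h] at hk
        simp at hk
    obtain ⟨c', hc', hspan⟩ := ih _ hlt (c + t • d) rfl
    exact ⟨c', hc'.trans hF, hspan⟩

end MimoAux

namespace MimoAux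
open MimoOptical

lemma HU_col {nt nr : ℕ} {H : Matrix (Fin nr) (Fin nt) ℝ} {U : Finset (Fin nt)}
    (hU : U.card = nr) : HU H U = H.submatrix id (fun i => U.orderEmbOfFin hU i) := by
  simp [HU, hU]

lemma HU_det {nt nr : ℕ} {H : Matrix (Fin nr) (Fin nt) ℝ} {U : Finset (Fin nt)}
    (hU : U ∈ goodSets H) : IsUnit (HU H U).det := by
  obtain ⟨hc, hli⟩ := hU
  rw [← Matrix.isUnit_iff_isUnit_det, ← Matrix.linearIndependent_cols_iff_isUnit]
  rw [HU_col hc]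
  exact hli.comp (fun i : Fin nr => (⟨U.orderEmbOfFin hc i, U.orderEmbOfFin_mem hc i⟩ : {x // x ∈ U}))
    (fun i j hij => by simpa using hij)

/-- the dual vertex -/
def cU {nt nr : ℕ} (H : Matrix (Fin nr) (Fin nt) ℝ) (U : Finset (Fin nt)) : Fin nr → ℝ :=
  (fun _ => 1) ᵥ* (HU H U)⁻¹

lemma cU_vecMul {nt nr : ℕ} (H : Matrix (Fin nr) (Fin nt) ℝ) (U : Finset (Fin nt)) (j : Fin nt) :
    (cU H U ᵥ* H) j = aUj H U j := by
  have : (cU H U ᵥ* H) j = cU H U ⬝ᵥ (fun r => H r j) := rfl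
  rw [this, cU, ← dotProduct_mulVec]
  simp [aUj, dotProduct]

lemma inv_mul_col {nt nr : ℕ} {H : Matrix (Fin nr) (Fin nt) ℝ} {U : Finset (Fin nt)}
    (hU : U ∈ goodSets H) (ℓ i : Fin nr) :
    ((HU H U)⁻¹ *ᵥ (fun r => H r (U.orderEmbOfFin hU.1 i))) ℓ = if ℓ = i then 1 else 0 := by
  have h1 : (fun r => H r (U.orderEmbOfFin hU.1 i)) = fun r => (HU H U) r i := by
    ext r; rw [HU_col hU.1]; rfl
  rw [h1]
  have h2 : ((HU H U)⁻¹ * (HU H U)) ℓ i = ((HU H U)⁻¹ *ᵥ (fun r => (HU H U) r i)) ℓ := rfl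
  rw [← h2, Matrix.nonsing_inv_mul _ (HU_det hU), Matrix.one_apply]

lemma aUj_mem {nt nr : ℕ} {H : Matrix (Fin nr) (Fin nt) ℝ} {U : Finset (Fin nt)}
    (hU : U ∈ goodSets H) (i : Fin nr) : aUj H U (U.orderEmbOfFin hU.1 i) = 1 := by
  simp [aUj, inv_mul_col hU]

lemma sum_good {nt nr : ℕ} {H : Matrix (Fin nr) (Fin nt) ℝ} {U : Finset (Fin nt)}
    (hU : U ∈ goodSets H) (f : Fin nt → ℝ) :
    ∑ j, f j = ∑ i, f (U.orderEmbOfFin hU.1 i) + ∑ j ∈ Uᶜ, f j := by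
  rw [← Finset.sum_add_sum_compl U f]
  congr 1
  rw [← Finset.sum_image (s := Finset.univ) (g := fun i => U.orderEmbOfFin hU.1 i) (f := f)]
  · congr 1
    ext j
    simp only [Finset.mem_image, Finset.mem_univ, true_and]
    have := U.range_orderEmbOfFin hU.1
    have h2 : j ∈ Set.range (U.orderEmbOfFin hU.1) ↔ j ∈ (U : Set (Fin nt)) := by rw [this]
    rw [Set.mem_range, Finset.mem_coe] at h2
    exact h2.symm
  · intro a _ b _ hab
    simpa using hab

lemma exists_good_of_span {nt nr : ℕ} (H : Matrix (Fin nr) (Fin nt) ℝ) (T : Set (Fin nt))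
    (hT : ∀ d : Fin nr → ℝ, (∀ j ∈ T, (d ᵥ* H) j = 0) → d = 0) :
    ∃ U ∈ goodSets H, ∀ j ∈ U, j ∈ T := by
  classical
  let M : Matrix (Fin nr) T ℝ := H.submatrix id (fun j : T => j.1)
  have hrow : LinearIndependent ℝ M.row := by
    rw [← Matrix.vecMul_injective_iff]
    rw [← Matrix.coe_vecMulLinear, ← LinearMap.ker_eq_bot, LinearMap.ker_eq_bot']
    intro d hd
    apply hT d
    intro j hj
    exact congrFun hd ⟨j, hj⟩
  have hr : M.rank = nr := by
    rw [linearIndependent_iff_card_eq_finrank_span, Set.finrank,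
      ← Matrix.rank_eq_finrank_span_row] at hrow
    simpa using hrow.symm
  obtain ⟨κ, a, ha, hspan, hli⟩ := exists_linearIndependent' ℝ M.col
  have : Finite κ := Finite.of_injective a ha
  have : Fintype κ := Fintype.ofFinite κ
  have hcard : Fintype.card κ = nr := by
    rw [linearIndependent_iff_card_eq_finrank_span.mp hli, Set.finrank, hspan,
      ← Matrix.rank_eq_finrank_span_cols, hr]
  have hainj : Function.Injective (fun k => (a k).1) := fun k k' h => ha (Subtype.ext h)
  refine ⟨Finset.univ.image (fun k => (a k).1), ⟨?_, ?_⟩, ?_⟩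
  · rw [Finset.card_image_of_injective _ hainj, Finset.card_univ, hcard]
  · have : ∀ j : {x // x ∈ Finset.univ.image (fun k => (a k).1)}, ∃ k, (a k).1 = j.1 := by
      intro j
      obtain ⟨k, -, hk⟩ := Finset.mem_image.mp j.2
      exact ⟨k, hk⟩
    choose g hg using this
    have hginj : Function.Injective g := by
      intro j j' h
      apply Subtype.ext
      rw [← hg j, ← hg j', h]
    have := hli.comp g hginj
    have heq : (fun j : {x // x ∈ Finset.univ.image (fun k => (a k).1)} => fun i => H i j.1)
        = (M.col ∘ a) ∘ g := by
      ext j i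
      simp [M, Function.comp, Matrix.col, hg j]
    rw [heq]
    exact this
  · intro j hj
    obtain ⟨k, -, rfl⟩ := Finset.mem_image.mp hj
    exact (a k).2

lemma eq_cU {nt nr : ℕ} {H : Matrix (Fin nr) (Fin nt) ℝ} {U : Finset (Fin nt)}
    (hU : U ∈ goodSets H) (c : Fin nr → ℝ) (hc : ∀ j ∈ U, (c ᵥ* H) j = 1) : c = cU H U := by
  have h1 : c ᵥ* HU H U = fun _ => 1 := by
    ext i
    rw [HU_col hU.1]
    exact hc _ (U.orderEmbOfFin_mem hU.1 i)
  rw [cU, ← h1, Matrix.vecMul_vecMul, Matrix.mul_nonsing_inv _ (HU_det hU), Matrix.vecMul_one]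

lemma exists_opt {nt nr : ℕ} (H : Matrix (Fin nr) (Fin nt) ℝ) (hrank : H.rank = nr) (A : ℝ)
    (x : Fin nt → ℝ) (hx : ∀ k, x k ∈ Set.Icc 0 A) :
    ∃ U ∈ goodSets H, ∀ c, dualF H A (H *ᵥ x) (cU H U) ≤ dualF H A (H *ᵥ x) c := by
  classical
  have hv : ∀ c, ∃ U ∈ goodSets H, dualF H A (H *ᵥ x) (cU H U) ≤ dualF H A (H *ᵥ x) c := by
    intro c
    obtain ⟨c', hc', hsp⟩ := exists_vertex H hrank A x hx _ c rfl
    obtain ⟨U, hU, hUT⟩ := exists_good_of_span H {j | (c' ᵥ* H) j = 1} hsp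
    refine ⟨U, hU, ?_⟩
    rw [← eq_cU hU c' hUT]
    exact hc'
  obtain ⟨U0, hU0, -⟩ := hv 0
  obtain ⟨U, hU, hmin⟩ := Set.exists_min_image (goodSets H)
    (fun U => dualF H A (H *ᵥ x) (cU H U)) (Set.toFinite _) ⟨U0, hU0⟩
  refine ⟨U, hU, fun c => ?_⟩
  obtain ⟨U', hU', h⟩ := hv c
  exact (hmin U' hU').trans h

lemma exists_eps {ι : Type*} [Fintype ι] (e f : ι → ℝ) :
    ∃ ε : ℝ, 0 < ε ∧ ∀ j, e j ≠ 0 → ε * |f j| ≤ |e j| := by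
  have h : ∀ j, ∃ ε : ℝ, 0 < ε ∧ (e j ≠ 0 → ε * |f j| ≤ |e j|) := by
    intro j
    by_cases h : e j = 0
    · exact ⟨1, one_pos, fun h' => absurd h h'⟩
    · have h1 : 0 < |e j| := abs_pos.mpr h
      refine ⟨|e j| / (|f j| + 1), by positivity, fun _ => ?_⟩
      rw [div_mul_eq_mul_div, div_le_iff₀ (by positivity)]
      nlinarith [abs_nonneg (f j)]
  choose g hg using h
  by_cases hne : Nonempty ι
  · obtain ⟨j0, -, hj0⟩ := Finset.univ.exists_min_image g Finset.univ_nonempty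
    refine ⟨g j0, (hg j0).1, fun j hj => ?_⟩
    have := (hg j).2 hj
    nlinarith [hj0 j (Finset.mem_univ j), abs_nonneg (f j)]
  · exact ⟨1, one_pos, fun j => absurd ⟨j⟩ hne⟩

/-- coordinates in the cell -/
def lamU {nt nr : ℕ} (H : Matrix (Fin nr) (Fin nt) ℝ) (A : ℝ) (U : Finset (Fin nt))
    (x : Fin nt → ℝ) : Fin nr → ℝ :=
  (HU H U)⁻¹ *ᵥ (H *ᵥ x - vU H A U)

lemma vU_eq {nt nr : ℕ} (H : Matrix (Fin nr) (Fin nt) ℝ) (A : ℝ) (U : Finset (Fin nt))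
    (d : Fin nr → ℝ) : d ⬝ᵥ vU H A U = A * ∑ j ∈ Uᶜ, gUj H U j * (d ᵥ* H) j := by
  have : ∀ j, (d ᵥ* H) j = ∑ r, d r * H r j := fun j => rfl
  simp only [this, dotProduct, vU, Finset.mul_sum]
  rw [Finset.sum_comm]
  refine Finset.sum_congr rfl fun j _ => Finset.sum_congr rfl fun r _ => ?_
  ring

lemma dualF_cU {nt nr : ℕ} {H : Matrix (Fin nr) (Fin nt) ℝ} {U : Finset (Fin nt)} (A : ℝ)
    (hU : U ∈ goodSets H) (x : Fin nt → ℝ) :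
    dualF H A (H *ᵥ x) (cU H U) = - (A * sU H U + ∑ ℓ, lamU H A U x ℓ) := by
  have h1 : ∑ ℓ, lamU H A U x ℓ = cU H U ⬝ᵥ (H *ᵥ x) - cU H U ⬝ᵥ vU H A U := by
    rw [← dotProduct_sub, cU, ← dotProduct_mulVec]
    simp [lamU, dotProduct]
  rw [h1, vU_eq, dualF, sum_good hU, sU]
  have h2 : ∀ i, max ((cU H U ᵥ* H) (U.orderEmbOfFin hU.1 i) - 1) 0 = 0 := by
    intro i; simp [cU_vecMul, aUj_mem hU]
  have h3 : ∀ j, max ((cU H U ᵥ* H) j - 1) 0 = gUj H U j * (cU H U ᵥ* H) j - gUj H U j := by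
    intro j
    rw [cU_vecMul, gUj]
    split_ifs with h
    · rw [max_eq_left (by linarith)]; ring
    · rw [max_eq_right (by linarith)]; ring
  simp only [h2, h3, Finset.sum_sub_distrib, Finset.sum_const_zero]
  ring

lemma dualF_perturb {nt nr : ℕ} {H : Matrix (Fin nr) (Fin nt) ℝ} {U : Finset (Fin nt)} (A : ℝ)
    (hU : U ∈ goodSets H) (x : Fin nt → ℝ) (ℓ : Fin nr) (t : ℝ)
    (ht : ∀ j ∉ U, |t| * |((HU H U)⁻¹ ℓ ᵥ* H) j| ≤ |aUj H U j - 1|) :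
    dualF H A (H *ᵥ x) (cU H U + t • (HU H U)⁻¹ ℓ) = dualF H A (H *ᵥ x) (cU H U)
      + A * max t 0 - t * lamU H A U x ℓ := by
  have hval : ∀ k, ((cU H U + t • (HU H U)⁻¹ ℓ) ᵥ* H) k
      = aUj H U k + t * ((HU H U)⁻¹ ℓ ᵥ* H) k := by
    intro k; simp [Matrix.add_vecMul, Matrix.smul_vecMul, cU_vecMul]
  have h1 : lamU H A U x ℓ = (HU H U)⁻¹ ℓ ⬝ᵥ (H *ᵥ x) - (HU H U)⁻¹ ℓ ⬝ᵥ vU H A U := by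
    rw [← dotProduct_sub]; rfl
  have h2 : ∀ i, max (((cU H U + t • (HU H U)⁻¹ ℓ) ᵥ* H) (U.orderEmbOfFin hU.1 i) - 1) 0
      = if ℓ = i then max t 0 else 0 := by
    intro i
    have : ((HU H U)⁻¹ ℓ ᵥ* H) (U.orderEmbOfFin hU.1 i) = if ℓ = i then 1 else 0 :=
      inv_mul_col hU ℓ i
    rw [hval, aUj_mem hU, this]
    split_ifs <;> simp
  have h2' : ∀ i, max ((cU H U ᵥ* H) (U.orderEmbOfFin hU.1 i) - 1) 0 = 0 := by
    intro i; simp [cU_vecMul, aUj_mem hU]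
  have h3 : ∀ j ∈ Uᶜ, max (((cU H U + t • (HU H U)⁻¹ ℓ) ᵥ* H) j - 1) 0
      = max ((cU H U ᵥ* H) j - 1) 0 + t * (gUj H U j * ((HU H U)⁻¹ ℓ ᵥ* H) j) := by
    intro j hj
    have hb := ht j (by simpa using hj)
    rw [← abs_mul] at hb
    rw [hval, cU_vecMul, gUj]
    generalize ((HU H U)⁻¹ ℓ ᵥ* H) j = f at *
    split_ifs with h
    · rw [abs_of_pos (a := aUj H U j - 1) (by linarith)] at hb
      have := (abs_le.mp hb).1
      rw [max_eq_left (by linarith), max_eq_left (by linarith)]; ring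
    · rw [abs_of_nonpos (a := aUj H U j - 1) (by linarith)] at hb
      have := (abs_le.mp hb).2
      rw [max_eq_right (by linarith), max_eq_right (by linarith)]; ring
  rw [h1, vU_eq, dualF, dualF, sum_good hU, sum_good hU, Finset.sum_congr rfl h3]
  simp only [h2, h2', Finset.sum_add_distrib, Finset.sum_const_zero, ← Finset.mul_sum,
    Finset.sum_ite_eq, Finset.mem_univ, if_true, add_dotProduct, smul_dotProduct, smul_eq_mul]
  ring

theorem geometry {nt nr : ℕ} (H : Matrix (Fin nr) (Fin nt) ℝ) (hrank : H.rank = nr) (A : ℝ)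
    (htie : ∀ U ∈ goodSets H, ∀ j ∉ U, aUj H U j ≠ 1)
    (x : Fin nt → ℝ) (hx : ∀ k, x k ∈ Set.Icc 0 A) :
    ∃ U ∈ goodSets H, (∀ ℓ, lamU H A U x ℓ ∈ Set.Icc 0 A) ∧
      A * sU H U + ∑ ℓ, lamU H A U x ℓ ≤ ∑ k, x k := by
  obtain ⟨U, hU, hopt⟩ := exists_opt H hrank A x hx
  refine ⟨U, hU, fun ℓ => ?_, ?_⟩
  · obtain ⟨ε, hε, hb⟩ := exists_eps (fun j => aUj H U j - 1) (fun j => ((HU H U)⁻¹ ℓ ᵥ* H) j)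
    have hb' : ∀ j ∉ U, ε * |((HU H U)⁻¹ ℓ ᵥ* H) j| ≤ |aUj H U j - 1| :=
      fun j hj => hb j (sub_ne_zero.mpr (htie U hU j hj))
    have hp := dualF_perturb A hU x ℓ ε (by rwa [abs_of_pos hε])
    have hn := dualF_perturb A hU x ℓ (-ε) (by rwa [abs_neg, abs_of_pos hε])
    have hp' := hopt (cU H U + ε • (HU H U)⁻¹ ℓ)
    have hn' := hopt (cU H U + (-ε) • (HU H U)⁻¹ ℓ)
    rw [hp, max_eq_left hε.le] at hp'
    rw [hn, max_eq_right (by linarith)] at hn'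
    constructor
    · nlinarith
    · nlinarith
  · have h1 := dualF_lower H A x hx (cU H U)
    rw [dualF_cU A hU] at h1
    linarith

end MimoAux

namespace MimoAux
open MimoOptical

/-- negative log of the (unnormalised) auxiliary density -/
def phi (σ A m y : ℝ) : ℝ :=
  if y < 0 then y ^ 2 / (2 * σ ^ 2) else if A < y then (y - A) ^ 2 / (2 * σ ^ 2)
    else 1 / 2 + m * y / A

/-- normalising constant -/
def KK (σ A m : ℝ) : ℝ :=
  σ + A / Real.sqrt (2 * Real.pi * Real.exp 1) * ((1 - Real.exp (-m)) / m)

lemma phi_nonneg (σ A m y : ℝ) (hA : 0 < A) (hm : 0 < m) : 0 ≤ phi σ A m y := by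
  unfold phi
  split_ifs with h1 h2
  · positivity
  · positivity
  · push Not at h1
    positivity

lemma phi_le (σ A m x z : ℝ) (hA : 0 < A) (hm : 0 < m) (hx : x ∈ Set.Icc 0 A) :
    phi σ A m (x + z) ≤ 1 / 2 + m + z ^ 2 / (2 * σ ^ 2) := by
  obtain ⟨hx0, hxA⟩ := hx
  have hz : 0 ≤ z ^ 2 / (2 * σ ^ 2) := by positivity
  unfold phi
  split_ifs with h1 h2
  · have : (x + z) ^ 2 / (2 * σ ^ 2) ≤ z ^ 2 / (2 * σ ^ 2) := by
      apply div_le_div_of_nonneg_right _ (by positivity)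
      nlinarith
    linarith
  · have : (x + z - A) ^ 2 / (2 * σ ^ 2) ≤ z ^ 2 / (2 * σ ^ 2) := by
      apply div_le_div_of_nonneg_right _ (by positivity)
      nlinarith
    linarith
  · have : m * (x + z) / A ≤ m := by
      rw [div_le_iff₀ hA]; nlinarith
    linarith

lemma measurable_phi (σ A m : ℝ) : Measurable (phi σ A m) := by
  unfold phi
  refine Measurable.ite measurableSet_Iio (by fun_prop) ?_
  exact Measurable.ite measurableSet_Ioi (by fun_prop) (by fun_prop)

lemma KK_pos (σ A m : ℝ) (hσ : 0 < σ) (hA : 0 < A) (hm : 0 < m) : 0 < KK σ A m := by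
  unfold KK
  have : 0 < 1 - Real.exp (-m) := by
    have : Real.exp (-m) < 1 := by rw [Real.exp_lt_one_iff]; linarith
    linarith
  positivity

lemma integral_Iio_gauss (σ : ℝ) (hσ : 0 < σ) :
    ∫ y in Set.Iio 0, Real.exp (-(y ^ 2 / (2 * σ ^ 2))) = σ * Real.sqrt (2 * Real.pi) / 2 := by
  rw [← integral_Iic_eq_integral_Iio]
  have h := integral_comp_neg_Iic 0 (fun y : ℝ => Real.exp (-(1 / (2 * σ ^ 2)) * y ^ 2))
  rw [neg_zero, integral_gaussian_Ioi] at h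
  have h2 : Real.sqrt (Real.pi / (1 / (2 * σ ^ 2))) = σ * Real.sqrt (2 * Real.pi) := by
    have : Real.pi / (1 / (2 * σ ^ 2)) = σ ^ 2 * (2 * Real.pi) := by field_simp
    rw [this, Real.sqrt_mul (by positivity), Real.sqrt_sq hσ.le]
  rw [← h2, ← h]
  congr 1
  ext y
  congr 1
  ring

lemma integral_Ioi_gauss (σ A : ℝ) (hσ : 0 < σ) :
    ∫ y in Set.Ioi A, Real.exp (-((y - A) ^ 2 / (2 * σ ^ 2))) = σ * Real.sqrt (2 * Real.pi) / 2 := by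
  have h2 : Real.sqrt (Real.pi / (1 / (2 * σ ^ 2))) = σ * Real.sqrt (2 * Real.pi) := by
    have : Real.pi / (1 / (2 * σ ^ 2)) = σ ^ 2 * (2 * Real.pi) := by field_simp
    rw [this, Real.sqrt_mul (by positivity), Real.sqrt_sq hσ.le]
  rw [← h2, ← integral_gaussian_Ioi, ← integral_indicator measurableSet_Ioi,
    ← integral_indicator measurableSet_Ioi,
    ← integral_sub_right_eq_self ((Set.Ioi 0).indicator
      (fun y : ℝ => Real.exp (-(1 / (2 * σ ^ 2)) * y ^ 2))) A]
  congr 1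
  ext y
  simp only [Set.indicator_apply, Set.mem_Ioi, sub_pos]
  split_ifs
  · congr 1; ring
  · rfl

lemma integrable_gauss (σ a : ℝ) (hσ : 0 < σ) :
    Integrable (fun y : ℝ => Real.exp (-((y - a) ^ 2 / (2 * σ ^ 2)))) := by
  have h := (integrable_exp_neg_mul_sq (b := 1 / (2 * σ ^ 2)) (by positivity)).comp_sub_right a
  convert h using 2 with y
  ring_nf

lemma integral_mid (A m : ℝ) (hA : 0 < A) (hm : 0 < m) :
    ∫ y in Set.Icc 0 A, Real.exp (-(1 / 2 + m * y / A))
      = Real.exp (-(1/2)) * (A * ((1 - Real.exp (-m)) / m)) := by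
  rw [integral_Icc_eq_integral_Ioc, ← intervalIntegral.integral_of_le hA.le]
  have hd : ∀ y ∈ Set.uIcc 0 A, HasDerivAt (fun y => -(A / m) * Real.exp (-(1 / 2 + m * y / A)))
      (Real.exp (-(1 / 2 + m * y / A))) y := by
    intro y _
    have h1 : HasDerivAt (fun y => -(1 / 2 + m * y / A)) (-(m / A)) y := by
      have := ((((hasDerivAt_id' y).const_mul m).div_const A).const_add (1/2 : ℝ)).fun_neg
      rw [mul_one] at this
      exact this
    have h2 := (h1.exp).const_mul (-(A / m))
    refine h2.congr_deriv ?_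
    have : -(A / m) * -(m / A) = 1 := by field_simp
    calc _ = (-(A / m) * -(m / A)) * Real.exp (-(1 / 2 + m * y / A)) := by ring
      _ = _ := by rw [this, one_mul]
  rw [intervalIntegral.integral_eq_sub_of_hasDerivAt hd]
  · have : Real.exp (-(1 / 2 + m * A / A)) = Real.exp (-(1/2)) * Real.exp (-m) := by
      rw [← Real.exp_add]; congr 1; field_simp; ring
    rw [this]
    simp only [mul_zero, zero_div, add_zero]
    field_simp
    ring
  · apply Continuous.intervalIntegrable
    fun_prop

lemma integral_phi (σ A m : ℝ) (hσ : 0 < σ) (hA : 0 < A) (hm : 0 < m) :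
    Integrable (fun y => Real.exp (- phi σ A m y) / Real.sqrt (2 * Real.pi)) ∧
    ∫ y, Real.exp (- phi σ A m y) / Real.sqrt (2 * Real.pi) = KK σ A m := by
  have hdec : (fun y => Real.exp (- phi σ A m y)) =
      fun y => (Set.Iio 0).indicator (fun y => Real.exp (-(y ^ 2 / (2 * σ ^ 2)))) y
      + (Set.Ioi A).indicator (fun y => Real.exp (-((y - A) ^ 2 / (2 * σ ^ 2)))) y
      + (Set.Icc 0 A).indicator (fun y => Real.exp (-(1 / 2 + m * y / A))) y := by
    ext y
    simp only [phi, Set.indicator_apply, Set.mem_Iio, Set.mem_Ioi, Set.mem_Icc]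
    by_cases h1 : y < 0
    · have h2 : ¬ A < y := by linarith
      have h3 : ¬ (0 ≤ y ∧ y ≤ A) := by intro h; linarith [h.1]
      simp [h1, h2, h3]
    · by_cases h2 : A < y
      · have h3 : ¬ (0 ≤ y ∧ y ≤ A) := by intro h; linarith [h.2]
        simp [h1, h2, h3]
      · have h3 : (0 ≤ y ∧ y ≤ A) := by constructor <;> linarith
        simp [h1, h2, h3]
  have i1 : Integrable ((Set.Iio (0:ℝ)).indicator (fun y => Real.exp (-(y ^ 2 / (2 * σ ^ 2))))) := by
    have := integrable_gauss σ 0 hσ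
    simp only [sub_zero] at this
    exact this.indicator measurableSet_Iio
  have i2 : Integrable ((Set.Ioi A).indicator
      (fun y => Real.exp (-((y - A) ^ 2 / (2 * σ ^ 2))))) :=
    (integrable_gauss σ A hσ).indicator measurableSet_Ioi
  have i3 : Integrable ((Set.Icc 0 A).indicator (fun y => Real.exp (-(1 / 2 + m * y / A)))) := by
    rw [integrable_indicator_iff measurableSet_Icc]
    apply Continuous.integrableOn_Icc
    fun_prop
  have hIntegr : Integrable (fun y => Real.exp (- phi σ A m y)) := by
    rw [hdec]; exact (i1.add i2).add i3
  refine ⟨hIntegr.div_const _, ?_⟩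
  rw [integral_div, hdec, integral_add (by exact i1.add i2) i3, integral_add i1 i2,
    integral_indicator measurableSet_Iio, integral_indicator measurableSet_Ioi,
    integral_indicator measurableSet_Icc, integral_Iio_gauss σ hσ, integral_Ioi_gauss σ A hσ,
    integral_mid A m hA hm, KK]
  have h1 : Real.sqrt (2 * Real.pi * Real.exp 1) = Real.sqrt (2 * Real.pi) * Real.exp (1/2) := by
    rw [Real.sqrt_mul (by positivity), Real.exp_half]
  rw [h1, Real.exp_neg]
  have hs : 0 < Real.sqrt (2 * Real.pi) := by positivity
  have he : 0 < Real.exp (1/2) := Real.exp_pos _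
  field_simp
  ring

end MimoAux

namespace MimoAux
open MimoOptical

/-- centred Gaussian density with standard deviation `σ` -/
def gp (σ z : ℝ) : ℝ := (σ * Real.sqrt (2 * Real.pi))⁻¹ * Real.exp (-(1 / (2 * σ ^ 2)) * z ^ 2)

lemma gp_pos (σ z : ℝ) (hσ : 0 < σ) : 0 < gp σ z := by
  unfold gp; positivity

lemma gp_eq (σ z : ℝ) (hσ : 0 < σ) (v : ℝ≥0) (hv : (v : ℝ) = σ ^ 2) :
    gaussianPDFReal 0 v z = gp σ z := by
  rw [gaussianPDFReal, gp, hv]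
  have : Real.sqrt (2 * Real.pi * σ ^ 2) = σ * Real.sqrt (2 * Real.pi) := by
    rw [mul_comm (2 * Real.pi), Real.sqrt_mul (by positivity), Real.sqrt_sq hσ.le]
  rw [this]
  congr 2
  ring

lemma gp_deriv (σ z : ℝ) : HasDerivAt (gp σ) (-(z / σ ^ 2) * gp σ z) z := by
  have h1 : HasDerivAt (fun z : ℝ => -(1 / (2 * σ ^ 2)) * z ^ 2)
      (-(1 / (2 * σ ^ 2)) * (2 * z)) z := by
    have := (hasDerivAt_pow 2 z).const_mul (-(1 / (2 * σ ^ 2)))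
    simpa using this
  have h2 := h1.exp.const_mul ((σ * Real.sqrt (2 * Real.pi))⁻¹)
  refine h2.congr_deriv ?_
  unfold gp
  ring

lemma gp_int0 (σ : ℝ) (hσ : 0 < σ) : Integrable (gp σ) :=
  (integrable_exp_neg_mul_sq (b := 1 / (2 * σ ^ 2)) (by positivity)).const_mul _

lemma gp_int1 (σ : ℝ) (hσ : 0 < σ) : Integrable (fun z => z * gp σ z) := by
  have := (integrable_mul_exp_neg_mul_sq (b := 1 / (2 * σ ^ 2)) (by positivity)).const_mul
    ((σ * Real.sqrt (2 * Real.pi))⁻¹)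
  refine this.congr (ae_of_all _ fun z => ?_)
  simp only [gp]; ring

lemma gp_int2 (σ : ℝ) (hσ : 0 < σ) : Integrable (fun z => z ^ 2 * gp σ z) := by
  have := (integrable_rpow_mul_exp_neg_mul_sq (b := 1 / (2 * σ ^ 2)) (by positivity)
    (s := 2) (by norm_num)).const_mul ((σ * Real.sqrt (2 * Real.pi))⁻¹)
  refine this.congr (ae_of_all _ fun z => ?_)
  simp only [gp, Real.rpow_ofNat]; ring

lemma gp_total (σ : ℝ) (hσ : 0 < σ) : ∫ z, gp σ z = 1 := by
  have hv0 : (σ ^ 2).toNNReal ≠ 0 := (Real.toNNReal_pos.2 (by positivity)).ne'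
  have := integral_gaussianPDFReal_eq_one 0 hv0
  rw [← this]
  congr 1
  ext z
  exact (gp_eq σ z hσ _ (Real.coe_toNNReal _ (sq_nonneg σ))).symm

/-- the Stein-type integrand -/
def stein (σ u z : ℝ) : ℝ := ((z ^ 2 - u * z) / σ ^ 2 - 1) * gp σ z

lemma stein_int (σ u : ℝ) (hσ : 0 < σ) : Integrable (stein σ u) := by
  have := (((gp_int2 σ hσ).sub ((gp_int1 σ hσ).const_mul u)).div_const (σ ^ 2)).sub (gp_int0 σ hσ)
  refine this.congr (ae_of_all _ fun z => ?_)
  simp only [stein, Pi.sub_apply]; ring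

lemma stein_deriv (σ u z : ℝ) :
    HasDerivAt (fun z => -(z - u) * gp σ z) (stein σ u z) z := by
  have h1 : HasDerivAt (fun z : ℝ => -(z - u)) (-1) z := ((hasDerivAt_id' z).sub_const u).fun_neg
  refine (h1.mul (gp_deriv σ z)).congr_deriv ?_
  unfold stein
  ring

lemma stein_prim_int (σ u : ℝ) (hσ : 0 < σ) : Integrable (fun z => -(z - u) * gp σ z) := by
  have := ((gp_int0 σ hσ).const_mul u).sub (gp_int1 σ hσ)
  refine this.congr (ae_of_all _ fun z => ?_)
  simp only [Pi.sub_apply]; ring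

lemma stein_Ioi (σ u : ℝ) (hσ : 0 < σ) : ∫ z in Set.Ioi u, stein σ u z = 0 := by
  rw [integral_Ioi_of_hasDerivAt_of_tendsto' (fun z _ => stein_deriv σ u z)
    (stein_int σ u hσ).integrableOn
    (tendsto_zero_of_hasDerivAt_of_integrableOn_Ioi (a := u) (fun z _ => stein_deriv σ u z)
      (stein_int σ u hσ).integrableOn (stein_prim_int σ u hσ).integrableOn)]
  simp

lemma stein_Iio (σ u : ℝ) (hσ : 0 < σ) : ∫ z in Set.Iio u, stein σ u z = 0 := by
  rw [← integral_Iic_eq_integral_Iio,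
    integral_Iic_of_hasDerivAt_of_tendsto' (fun z _ => stein_deriv σ u z)
    (stein_int σ u hσ).integrableOn
    (tendsto_zero_of_hasDerivAt_of_integrableOn_Iic (a := u) (fun z _ => stein_deriv σ u z)
      (stein_int σ u hσ).integrableOn (stein_prim_int σ u hσ).integrableOn)]
  simp

lemma gp_mid (σ a b : ℝ) (hσ : 0 < σ) (hab : a ≤ b) :
    ∫ z in Set.Icc a b, z * gp σ z = σ ^ 2 * (gp σ a - gp σ b) := by
  rw [integral_Icc_eq_integral_Ioc, ← intervalIntegral.integral_of_le hab]
  have hd : ∀ z ∈ Set.uIcc a b, HasDerivAt (fun z => - σ ^ 2 * gp σ z) (z * gp σ z) z := by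
    intro z _
    refine ((gp_deriv σ z).const_mul (- σ ^ 2)).congr_deriv ?_
    field_simp
  rw [intervalIntegral.integral_eq_sub_of_hasDerivAt hd (gp_int1 σ hσ).intervalIntegrable]
  ring

lemma phi_pointwise (σ A m x z : ℝ) (hσ : 0 < σ) (hA : 0 < A)
    (hx : x ∈ Set.Icc 0 A) :
    gp σ z * phi σ A m (x + z) ≤ 1 / 2 * gp σ z
      + 1 / 2 * (Set.Iio (-x)).indicator (stein σ (-x)) z
      + 1 / 2 * (Set.Ioi (A - x)).indicator (stein σ (A - x)) z
      + m / A * (Set.Icc (-x) (A - x)).indicator (fun z => x * gp σ z + z * gp σ z) z := by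
  obtain ⟨hx0, hxA⟩ := hx
  have hg := gp_pos σ z hσ
  simp only [phi, Set.indicator_apply, Set.mem_Iio, Set.mem_Ioi, Set.mem_Icc, stein]
  by_cases h1 : z < -x
  · have h1' : x + z < 0 := by linarith
    have h2 : ¬ A - x < z := by linarith
    have h3 : ¬ (-x ≤ z ∧ z ≤ A - x) := by intro h; linarith [h.1]
    simp only [h1, h1', h2, h3, if_true, if_false]
    have : (x + z) ^ 2 / (2 * σ ^ 2) ≤ 1 / 2 * ((z ^ 2 - -x * z) / σ ^ 2) := by
      rw [div_le_iff₀ (by positivity)]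
      have : 1 / 2 * ((z ^ 2 - -x * z) / σ ^ 2) * (2 * σ ^ 2) = z ^ 2 + x * z := by
        field_simp; ring
      rw [this]; nlinarith
    nlinarith
  · have h1' : ¬ x + z < 0 := by linarith
    by_cases h2 : A - x < z
    · have h2' : A < x + z := by linarith
      have h3 : ¬ (-x ≤ z ∧ z ≤ A - x) := by intro h; linarith [h.2]
      simp only [h1, h1', h2, h2', h3, if_true, if_false]
      have : (x + z - A) ^ 2 / (2 * σ ^ 2) ≤ 1 / 2 * ((z ^ 2 - (A - x) * z) / σ ^ 2) := by
        rw [div_le_iff₀ (by positivity)]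
        have : 1 / 2 * ((z ^ 2 - (A - x) * z) / σ ^ 2) * (2 * σ ^ 2) = z ^ 2 - (A - x) * z := by
          field_simp
        rw [this]; nlinarith
      nlinarith
    · have h2' : ¬ A < x + z := by linarith
      have h3 : (-x ≤ z ∧ z ≤ A - x) := by constructor <;> linarith
      simp only [h1, h1', h2, h2', h3, if_true, if_false, and_self]
      apply le_of_eq
      ring

lemma phi_expect (σ A m x : ℝ) (hσ : 0 < σ) (hA : 0 < A) (hm : 0 < m) (hx : x ∈ Set.Icc 0 A)
    (v : ℝ≥0) (hv : (v : ℝ) = σ ^ 2) :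
    ∫ z, phi σ A m (x + z) ∂(gaussianReal 0 v) ≤ 1 / 2 + m / A *
      (x + σ / Real.sqrt (2 * Real.pi) * (1 - Real.exp (-(A ^ 2) / (2 * σ ^ 2)))) := by
  have hv0 : v ≠ 0 := by
    intro h; rw [h, NNReal.coe_zero] at hv; have := pow_pos hσ 2; linarith
  rw [integral_gaussianReal_eq_integral_smul hv0]
  simp only [smul_eq_mul, gp_eq σ _ hσ v hv]
  have i0 := (gp_int0 σ hσ).const_mul (1 / 2)
  have i1 := ((stein_int σ (-x) hσ).indicator (measurableSet_Iio (a := -x))).const_mul (1 / 2)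
  have i2 := ((stein_int σ (A - x) hσ).indicator (measurableSet_Ioi (a := A - x))).const_mul (1 / 2)
  have i3' : Integrable (fun z => x * gp σ z + z * gp σ z) :=
    ((gp_int0 σ hσ).const_mul x).add (gp_int1 σ hσ)
  have i3 := (i3'.indicator (measurableSet_Icc (a := -x) (b := A - x))).const_mul (m / A)
  have i01 : Integrable (fun z => 1 / 2 * gp σ z
      + 1 / 2 * (Set.Iio (-x)).indicator (stein σ (-x)) z) := i0.add i1
  have i012 : Integrable (fun z => 1 / 2 * gp σ z
      + 1 / 2 * (Set.Iio (-x)).indicator (stein σ (-x)) z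
      + 1 / 2 * (Set.Ioi (A - x)).indicator (stein σ (A - x)) z) := i01.add i2
  refine (integral_mono_of_nonneg (ae_of_all _ fun z => ?_) (i012.add i3)
    (ae_of_all _ fun z => phi_pointwise σ A m x z hσ hA hx)).trans ?_
  · exact mul_nonneg (gp_pos σ z hσ).le (phi_nonneg σ A m _ hA hm)
  have := integral_add i012 i3
  simp only [Pi.add_apply] at this ⊢
  rw [this, integral_add i01 i2, integral_add i0 i1]
  simp only [integral_const_mul]
  rw [integral_indicator measurableSet_Iio, integral_indicator measurableSet_Ioi,
    integral_indicator measurableSet_Icc, stein_Iio σ _ hσ, stein_Ioi σ _ hσ, gp_total σ hσ,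
    integral_add ((gp_int0 σ hσ).const_mul x).integrableOn (gp_int1 σ hσ).integrableOn,
    gp_mid σ _ _ hσ (by linarith), integral_const_mul]
  obtain ⟨hx0, hxA⟩ := hx
  have hP : ∫ z in Set.Icc (-x) (A - x), gp σ z ≤ 1 := by
    rw [← gp_total σ hσ]
    exact setIntegral_le_integral (gp_int0 σ hσ) (ae_of_all _ fun z => (gp_pos σ z hσ).le)
  have hs : 0 < Real.sqrt (2 * Real.pi) := by positivity
  have hg : σ ^ 2 * (gp σ (-x) - gp σ (A - x))
      ≤ σ / Real.sqrt (2 * Real.pi) * (1 - Real.exp (-(A ^ 2) / (2 * σ ^ 2))) := by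
    have e1 : Real.exp (-(1 / (2 * σ ^ 2)) * (-x) ^ 2) ≤ 1 := by
      rw [Real.exp_le_one_iff]
      have : 0 ≤ 1 / (2 * σ ^ 2) * (-x) ^ 2 := by positivity
      linarith
    have e2 : Real.exp (-(A ^ 2) / (2 * σ ^ 2)) ≤ Real.exp (-(1 / (2 * σ ^ 2)) * (A - x) ^ 2) := by
      rw [Real.exp_le_exp]
      have h1 : 0 < 1 / (2 * σ ^ 2) := by positivity
      have : -(A ^ 2) / (2 * σ ^ 2) = -(1 / (2 * σ ^ 2)) * A ^ 2 := by ring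
      rw [this]
      have h2 : (A - x) ^ 2 ≤ A ^ 2 := by nlinarith
      nlinarith
    have : σ ^ 2 * (gp σ (-x) - gp σ (A - x)) = σ / Real.sqrt (2 * Real.pi) *
      (Real.exp (-(1 / (2 * σ ^ 2)) * (-x) ^ 2) - Real.exp (-(1 / (2 * σ ^ 2)) * (A - x) ^ 2)) := by
      unfold gp
      field_simp
    rw [this]
    apply mul_le_mul_of_nonneg_left _ (by positivity)
    linarith
  have hmA : 0 < m / A := by positivity
  have hx' : x * ∫ z in Set.Icc (-x) (A - x), gp σ z ≤ x := by nlinarith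
  have := mul_le_mul_of_nonneg_left (add_le_add hx' hg) hmA.le
  linarith

end MimoAux

namespace MimoAux
open MimoOptical

instance stdGaussian_prob (n : ℕ) : IsProbabilityMeasure (MimoOptical.stdGaussian n) := by
  unfold MimoOptical.stdGaussian; infer_instance

lemma std_eval (n : ℕ) (i : Fin n) :
    MeasurePreserving (fun z : Fin n → ℝ => z i) (MimoOptical.stdGaussian n) (gaussianReal 0 1) :=
  measurePreserving_eval (fun _ : Fin n => gaussianReal 0 1) i

lemma std_memLp (n : ℕ) (i : Fin n) : MemLp (fun z : Fin n → ℝ => z i) 2 (MimoOptical.stdGaussian n) := by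
  have h : MemLp (id : ℝ → ℝ) 2 (gaussianReal 0 1) := memLp_id_gaussianReal 2
  exact h.comp_measurePreserving (std_eval n i)

lemma std_int_sq (n : ℕ) (i : Fin n) : Integrable (fun z : Fin n → ℝ => z i ^ 2) (MimoOptical.stdGaussian n) :=
  (std_memLp n i).integrable_sq

lemma std_integral (n : ℕ) (i : Fin n) : ∫ z, z i ∂(MimoOptical.stdGaussian n) = 0 := by
  have h := (std_eval n i).map_eq
  have : ∫ x, x ∂((MimoOptical.stdGaussian n).map (fun z : Fin n → ℝ => z i)) = 0 := by
    rw [h, integral_id_gaussianReal]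
  rw [integral_map (std_eval n i).measurable.aemeasurable (by fun_prop)] at this
  exact this

lemma std_integral_sq (n : ℕ) (i : Fin n) : ∫ z, z i ^ 2 ∂(MimoOptical.stdGaussian n) = 1 := by
  have h := (std_eval n i).map_eq
  have hv : Var[fun x => x; gaussianReal 0 1] = 1 := by simp
  rw [variance_eq_integral (by fun_prop)] at hv
  simp only [integral_id_gaussianReal, sub_zero] at hv
  rw [← h, integral_map (std_eval n i).measurable.aemeasurable (by fun_prop)] at hv
  exact hv

lemma std_lin_law (n : ℕ) (c : Fin n → ℝ) :
    (MimoOptical.stdGaussian n).map (fun z => ∑ i, c i * z i) = gaussianReal 0 (∑ i, c i ^ 2).toNNReal := by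
  have hL : ∀ i, MemLp (fun x : ℝ => c i * x) 2 (gaussianReal 0 1) := fun i =>
    (memLp_id_gaussianReal (μ := 0) (v := 1) 2).const_mul (c i)
  have hind : iIndepFun (fun i (z : Fin n → ℝ) => c i * z i) (MimoOptical.stdGaussian n) :=
    iIndepFun_pi (μ := fun _ : Fin n => gaussianReal 0 1) (X := fun i x => c i * x)
      (fun i => by fun_prop)
  have hg : ∀ i, HasGaussianLaw (fun z : Fin n → ℝ => c i * z i) (MimoOptical.stdGaussian n) := by
    intro i
    constructor
    have : (MimoOptical.stdGaussian n).map (fun z : Fin n → ℝ => c i * z i)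
        = (gaussianReal 0 1).map (fun x => c i * x) := by
      rw [← (std_eval n i).map_eq, Measure.map_map (by fun_prop) (by fun_prop)]
      rfl
    rw [this, gaussianReal_map_const_mul]
    infer_instance
  have h := (hind.hasGaussianLaw_fun_sum hg).map_eq_gaussianReal
  rw [h]
  congr 1
  · rw [integral_finsetSum _ (fun i _ => ((std_memLp n i).integrable (by norm_num)).const_mul _)]
    simp [integral_const_mul, std_integral]
  · have h2 := variance_sum_pi (μ := fun _ : Fin n => gaussianReal 0 1)
      (X := fun i x => c i * x) hL
    have h3 : (∑ i, fun ω : Fin n → ℝ => c i * ω i) = fun z => ∑ i, c i * z i := by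
      ext z; simp
    rw [h3] at h2
    rw [MimoOptical.stdGaussian, h2]
    congr 1
    refine Finset.sum_congr rfl fun i _ => ?_
    rw [variance_const_mul]
    simp

lemma sigma_sq {nt nr : ℕ} (H : Matrix (Fin nr) (Fin nt) ℝ) (U : Finset (Fin nt)) (ℓ : Fin nr) :
    sigmaUl H U ℓ ^ 2 = ∑ i, ((HU H U)⁻¹ ℓ i) ^ 2 := by
  unfold sigmaUl
  have : (((HU H U)⁻¹) * ((HU H U)⁻¹)ᵀ) ℓ ℓ = ∑ i, ((HU H U)⁻¹ ℓ i) ^ 2 := by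
    rw [Matrix.mul_apply]
    refine Finset.sum_congr rfl fun i _ => ?_
    rw [Matrix.transpose_apply, sq]
  rw [this, Real.sq_sqrt (Finset.sum_nonneg fun i _ => sq_nonneg _)]

lemma sigma_pos {nt nr : ℕ} {H : Matrix (Fin nr) (Fin nt) ℝ} {U : Finset (Fin nt)}
    (hU : U ∈ goodSets H) (ℓ : Fin nr) : 0 < sigmaUl H U ℓ := by
  have h0 : 0 ≤ sigmaUl H U ℓ := Real.sqrt_nonneg _
  refine lt_of_le_of_ne h0 fun h => ?_
  have h1 := sigma_sq H U ℓ
  rw [← h] at h1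
  have h2 : ∀ i, (HU H U)⁻¹ ℓ i = 0 := by
    intro i
    have := (Finset.sum_eq_zero_iff_of_nonneg (s := Finset.univ)
      (f := fun i => ((HU H U)⁻¹ ℓ i) ^ 2) fun i _ => sq_nonneg _).1 (by rw [← h1]; norm_num) i (Finset.mem_univ i)
    exact pow_eq_zero_iff (two_ne_zero) |>.1 this
  have h3 := congrFun (congrFun (Matrix.nonsing_inv_mul _ (HU_det hU)) ℓ) ℓ
  rw [Matrix.mul_apply] at h3
  simp [h2] at h3

lemma phi_expect_vec {nt nr : ℕ} {H : Matrix (Fin nr) (Fin nt) ℝ} {U : Finset (Fin nt)}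
    (hU : U ∈ goodSets H) (A m x : ℝ) (hA : 0 < A) (hm : 0 < m) (hx : x ∈ Set.Icc 0 A)
    (ℓ : Fin nr) :
    ∫ z, phi (sigmaUl H U ℓ) A m (x + ((HU H U)⁻¹ *ᵥ z) ℓ) ∂(MimoOptical.stdGaussian nr) ≤
      1 / 2 + m / A * (x + sigmaUl H U ℓ / Real.sqrt (2 * Real.pi) *
        (1 - Real.exp (-(A ^ 2) / (2 * sigmaUl H U ℓ ^ 2)))) := by
  have h := std_lin_law nr ((HU H U)⁻¹ ℓ)
  have h2 := phi_expect (sigmaUl H U ℓ) A m x (sigma_pos hU ℓ) hA hm hx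
    (∑ i, ((HU H U)⁻¹ ℓ i) ^ 2).toNNReal
    (by rw [Real.coe_toNNReal _ (Finset.sum_nonneg fun i _ => sq_nonneg _), sigma_sq])
  have hm1 : Measurable fun z : Fin nr → ℝ => ∑ i, (HU H U)⁻¹ ℓ i * z i :=
    Finset.measurable_sum _ fun i _ => (measurable_pi_apply i).const_mul _
  have hm2 : Measurable fun z => phi (sigmaUl H U ℓ) A m (x + z) :=
    (measurable_phi _ A m).comp (measurable_const_add x)
  rw [← h, integral_map hm1.aemeasurable hm2.aestronglyMeasurable] at h2
  exact h2
end MimoAux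

namespace MimoAux
open MimoOptical

lemma gibbs {Ω : Type*} [MeasurableSpace Ω] (P : Measure Ω) [IsProbabilityMeasure P] (g : Ω → ℝ)
    (hg : Integrable g P) (h1 : ∫⁻ ω, ENNReal.ofReal (Real.exp (-g ω)) ∂P ≤ 1) :
    0 ≤ ∫ ω, g ω ∂P := by
  have hae : AEStronglyMeasurable (fun ω => Real.exp (-g ω)) P :=
    Real.continuous_exp.comp_aestronglyMeasurable hg.aestronglyMeasurable.neg
  have hIntegr : Integrable (fun ω => Real.exp (-g ω)) P := by
    refine ⟨hae, ?_⟩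
    rw [hasFiniteIntegral_iff_ofReal (ae_of_all _ fun ω => (Real.exp_pos _).le)]
    exact h1.trans_lt ENNReal.one_lt_top
  have h2 : ∫ ω, Real.exp (-g ω) ∂P ≤ 1 := by
    rw [integral_eq_lintegral_of_nonneg_ae (ae_of_all _ fun ω => (Real.exp_pos _).le) hae]
    exact ENNReal.toReal_le_of_le_ofReal zero_le_one (by simpa using h1)
  have h3 : ∫ ω, (1 - g ω) ∂P ≤ ∫ ω, Real.exp (-g ω) ∂P := by
    refine integral_mono ((integrable_const 1).sub hg) hIntegr fun ω => ?_
    have := Real.add_one_le_exp (-g ω)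
    linarith
  rw [integral_sub (integrable_const 1) hg] at h3
  simp at h3
  linarith

theorem duality {β γ : Type*} [MeasurableSpace β] [MeasurableSpace γ]
    (μ : Measure β) [IsProbabilityMeasure μ] (ν : Measure γ) [SigmaFinite ν]
    (w : β × γ → ℝ) (hw : Measurable w) (hwpos : ∀ q, 0 < w q)
    (hw1 : ∀ x, ∫⁻ y, ENNReal.ofReal (w (x, y)) ∂ν = 1)
    (S : β × γ → ℝ) (R : γ → ℝ) (hR : Measurable R)
    (hSR : ∀ q, S q ≤ R q.2) (hR1 : ∫⁻ y, ENNReal.ofReal (R y) ∂ν ≤ 1)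
    (P : Measure (β × γ)) (hP : P = (μ.prod ν).withDensity (fun q => ENNReal.ofReal (w q)))
    (hSpos : ∀ᵐ q ∂P, 0 < S q)
    (hb : Integrable (fun q => Real.log (w q) - Real.log (S q)) P) :
    mutualInfoJoint P ≤ ∫ q, (Real.log (w q) - Real.log (S q)) ∂P := by
  have hwE : Measurable fun q => ENNReal.ofReal (w q) := hw.ennreal_ofReal
  have hwS : Measurable fun q : γ × β => ENNReal.ofReal (w (q.2, q.1)) :=
    hwE.comp measurable_swap
  set f : γ → ℝ≥0∞ := fun y => ∫⁻ x, ENNReal.ofReal (w (x, y)) ∂μ with hf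
  have hfm : Measurable f := hwS.lintegral_prod_right'
  have hfst : P.map Prod.fst = μ := by
    refine Measure.ext_of_lintegral _ fun φ hφ => ?_
    have hφ1 : Measurable fun q : β × γ => φ q.1 := hφ.comp measurable_fst
    rw [lintegral_map hφ measurable_fst, hP,
      lintegral_withDensity_eq_lintegral_mul _ hwE hφ1,
      lintegral_prod _ (hwE.mul hφ1).aemeasurable]
    refine lintegral_congr fun x => ?_
    simp only [Pi.mul_apply]
    have hwx : Measurable fun y => ENNReal.ofReal (w (x, y)) := hwE.comp measurable_prodMk_left
    rw [lintegral_mul_const _ hwx, hw1, one_mul]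
  have hsnd : P.map Prod.snd = ν.withDensity f := by
    refine Measure.ext_of_lintegral _ fun φ hφ => ?_
    have hφ1 : Measurable fun q : β × γ => φ q.2 := hφ.comp measurable_snd
    rw [lintegral_map hφ measurable_snd, hP,
      lintegral_withDensity_eq_lintegral_mul _ hwE hφ1,
      lintegral_withDensity_eq_lintegral_mul _ hfm hφ,
      lintegral_prod_symm _ (hwE.mul hφ1).aemeasurable]
    refine lintegral_congr fun y => ?_
    simp only [Pi.mul_apply]
    have hwy : Measurable fun x => ENNReal.ofReal (w (x, y)) := hwE.comp measurable_prodMk_right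
    rw [lintegral_mul_const _ hwy]
  have hPprob : IsProbabilityMeasure P := by
    constructor
    have : P Set.univ = (P.map Prod.fst) Set.univ := by
      rw [Measure.map_apply measurable_fst MeasurableSet.univ, Set.preimage_univ]
    rw [this, hfst, measure_univ]
  have hf1 : ∫⁻ y, f y ∂ν = 1 := by
    have : (P.map Prod.snd) Set.univ = 1 := by
      rw [Measure.map_apply measurable_snd MeasurableSet.univ, Set.preimage_univ, measure_univ]
    rw [hsnd, withDensity_apply _ MeasurableSet.univ, Measure.restrict_univ] at this
    exact this
  have hftop : ∀ᵐ y ∂ν, f y ≠ ∞ := by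
    filter_upwards [ae_lt_top hfm (by rw [hf1]; exact ENNReal.one_ne_top)] with y hy using hy.ne
  have hf0 : ∀ y, f y ≠ 0 := by
    intro y h
    rw [hf] at h
    simp only at h
    have hwy : Measurable fun x => ENNReal.ofReal (w (x, y)) := hwE.comp measurable_prodMk_right
    rw [lintegral_eq_zero_iff hwy] at h
    have h2 : ∀ᵐ x ∂μ, False := by
      filter_upwards [h] with x hx
      have := hwpos (x, y)
      simp at hx
      linarith
    simp at h2
    exact IsProbabilityMeasure.ne_zero μ h2
  set Q : Measure (β × γ) := (P.map Prod.fst).prod (P.map Prod.snd) with hQ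
  have hsf : IsProbabilityMeasure (ν.withDensity f) := by
    rw [← hsnd]; exact Measure.isProbabilityMeasure_map measurable_snd.aemeasurable
  have hQ2 : Q = (μ.prod ν).withDensity (fun q => f q.2) := by
    rw [hQ, hfst, hsnd, prod_withDensity_right hfm]
  have hftop2 : ∀ᵐ q ∂(μ.prod ν), f q.2 ≠ ∞ :=
    Measure.quasiMeasurePreserving_snd.ae hftop
  have hfs : Measurable fun q : β × γ => f q.2 := hfm.comp measurable_snd
  have hdiv : Measurable fun q : β × γ => ENNReal.ofReal (w q) / f q.2 := hwE.div hfs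
  have hPQ : P = Q.withDensity (fun q => ENNReal.ofReal (w q) / f q.2) := by
    rw [hQ2, ← withDensity_mul _ hfs hdiv, hP]
    refine withDensity_congr_ae ?_
    filter_upwards [hftop2] with q hq
    rw [Pi.mul_apply, ENNReal.mul_div_cancel (hf0 _) hq]
  have hQprob : IsProbabilityMeasure Q := by
    rw [hQ, hfst, hsnd]; infer_instance
  have hac : P ≪ Q := by rw [hPQ]; exact withDensity_absolutelyContinuous _ _
  have hac2 : P ≪ μ.prod ν := by rw [hP]; exact withDensity_absolutelyContinuous _ _
  have hrn : P.rnDeriv Q =ᵐ[P] fun q => ENNReal.ofReal (w q) / f q.2 := by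
    have := Measure.rnDeriv_withDensity Q hdiv
    rw [← hPQ] at this
    exact hac.ae_le this
  have hfP : ∀ᵐ q ∂P, f q.2 ≠ ∞ := hac2.ae_le hftop2
  set a : β × γ → ℝ := fun q => Real.log (w q) - Real.log (f q.2).toReal with ha
  have hMI : mutualInfoJoint P = ∫ q, a q ∂P := by
    unfold mutualInfoJoint klDivR
    refine integral_congr_ae ?_
    filter_upwards [hrn, hfP] with q hq hq2
    rw [hq, ENNReal.toReal_div, ENNReal.toReal_ofReal (hwpos q).le,
      Real.log_div (hwpos q).ne' (ENNReal.toReal_ne_zero.2 ⟨hf0 _, hq2⟩)]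
  rw [hMI]
  by_cases hai : Integrable a P
  · have := gibbs P (fun q => (Real.log (w q) - Real.log (S q)) - a q) (hb.sub hai) ?_
    · rw [integral_sub hb hai] at this
      linarith
    · have h1 : ∫⁻ q, ENNReal.ofReal (Real.exp (-((Real.log (w q) - Real.log (S q)) - a q))) ∂P
          ≤ ∫⁻ q, ENNReal.ofReal (R q.2) / f q.2 ∂P := by
        refine lintegral_mono_ae ?_
        filter_upwards [hSpos, hfP] with q hq hq2
        have hfp : 0 < (f q.2).toReal := ENNReal.toReal_pos (hf0 _) hq2
        have : -((Real.log (w q) - Real.log (S q)) - a q)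
            = Real.log (S q) - Real.log (f q.2).toReal := by simp only [ha]; ring
        rw [this, Real.exp_sub, Real.exp_log hq, Real.exp_log hfp,
          ENNReal.ofReal_div_of_pos hfp, ENNReal.ofReal_toReal hq2]
        exact ENNReal.div_le_div_right (ENNReal.ofReal_le_ofReal (hSR q)) _
      refine h1.trans ?_
      have hm : Measurable fun y => ENNReal.ofReal (R y) / f y := hR.ennreal_ofReal.div hfm
      have h2 : ∫⁻ q, ENNReal.ofReal (R q.2) / f q.2 ∂P
          = ∫⁻ y, ENNReal.ofReal (R y) / f y ∂(P.map Prod.snd) :=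
        (lintegral_map hm measurable_snd).symm
      rw [h2, hsnd, lintegral_withDensity_eq_lintegral_mul _ hfm hm]
      refine le_trans (lintegral_mono fun y => ?_) hR1
      simp only [Pi.mul_apply]
      exact ENNReal.mul_div_le
  · rw [integral_undef hai]
    refine gibbs P _ hb ?_
    have h1 : ∫⁻ q, ENNReal.ofReal (Real.exp (-(Real.log (w q) - Real.log (S q)))) ∂P
          ≤ ∫⁻ q, ENNReal.ofReal (R q.2) / ENNReal.ofReal (w q) ∂P := by
      refine lintegral_mono_ae ?_
      filter_upwards [hSpos] with q hq
      rw [neg_sub, Real.exp_sub, Real.exp_log hq, Real.exp_log (hwpos q),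
        ENNReal.ofReal_div_of_pos (hwpos q)]
      exact ENNReal.div_le_div_right (ENNReal.ofReal_le_ofReal (hSR q)) _
    refine h1.trans ?_
    have hRm : Measurable fun q : β × γ => ENNReal.ofReal (R q.2) :=
      hR.ennreal_ofReal.comp measurable_snd
    have hRw : Measurable fun q : β × γ => ENNReal.ofReal (R q.2) / ENNReal.ofReal (w q) :=
      hRm.div hwE
    rw [hP, lintegral_withDensity_eq_lintegral_mul _ hwE hRw]
    have h2 : ∫⁻ q, ENNReal.ofReal (R q.2) ∂(μ.prod ν) ≤ 1 := by
      rw [lintegral_prod _ hRm.aemeasurable]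
      simpa using hR1
    refine le_trans (lintegral_mono fun q => ?_) h2
    simp only [Pi.mul_apply]
    exact ENNReal.mul_div_le

lemma lint_prod {n : ℕ} (f : Fin n → ℝ → ℝ) (hf : ∀ i, Integrable (f i)) (h0 : ∀ i x, 0 ≤ f i x) :
    ∫⁻ x : Fin n → ℝ, ENNReal.ofReal (∏ i, f i (x i)) = ∏ i, ENNReal.ofReal (∫ x, f i x) := by
  have hi : Integrable (fun x : Fin n → ℝ => ∏ i, f i (x i)) := Integrable.fintype_prod hf
  rw [← ofReal_integral_eq_lintegral_ofReal hi
    (ae_of_all _ fun x => Finset.prod_nonneg fun i _ => h0 i _),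
    integral_fintype_prod_volume_eq_prod,
    ENNReal.ofReal_prod_of_nonneg fun i _ => integral_nonneg (h0 i)]

/-- standard Gaussian density -/
def gd {n : ℕ} (z : Fin n → ℝ) : ℝ := ∏ i, gaussianPDFReal 0 1 (z i)

lemma gd_pos {n : ℕ} (z : Fin n → ℝ) : 0 < gd z :=
  Finset.prod_pos fun _ _ => gaussianPDFReal_pos _ _ _ one_ne_zero

lemma gd_measurable {n : ℕ} : Measurable (gd (n := n)) :=
  Finset.measurable_prod _ fun i _ => (measurable_gaussianPDFReal 0 1).comp (measurable_pi_apply i)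

lemma gd_log {n : ℕ} (z : Fin n → ℝ) :
    Real.log (gd z) = -(n : ℝ) * Real.log (Real.sqrt (2 * Real.pi)) - (∑ i, z i ^ 2) / 2 := by
  unfold gd
  rw [Real.log_prod (fun i _ => (gaussianPDFReal_pos _ _ _ one_ne_zero).ne')]
  have : ∀ i, Real.log (gaussianPDFReal 0 1 (z i))
      = - Real.log (Real.sqrt (2 * Real.pi)) - z i ^ 2 / 2 := by
    intro i
    rw [gaussianPDFReal, Real.log_mul (by positivity) (Real.exp_pos _).ne', Real.log_exp,
      Real.log_inv]
    simp
    ring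
  simp only [this, Finset.sum_sub_distrib, Finset.sum_div]
  simp

lemma std_density (n : ℕ) :
    MimoOptical.stdGaussian n = (volume : Measure (Fin n → ℝ)).withDensity
      (fun z => ENNReal.ofReal (gd z)) := by
  unfold MimoOptical.stdGaussian
  refine Measure.pi_eq fun s hs => ?_
  rw [withDensity_apply _ (MeasurableSet.univ_pi hs), ← lintegral_indicator (MeasurableSet.univ_pi hs)]
  have h1 : ∀ z : Fin n → ℝ, (Set.univ.pi s).indicator (fun z => ENNReal.ofReal (gd z)) z
      = ENNReal.ofReal (∏ i, (s i).indicator (gaussianPDFReal 0 1) (z i)) := by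
    intro z
    by_cases hz : z ∈ Set.univ.pi s
    · rw [Set.indicator_of_mem hz, gd]
      congr 1
      refine Finset.prod_congr rfl fun i _ => ?_
      rw [Set.indicator_of_mem (hz i (Set.mem_univ i))]
    · rw [Set.indicator_of_notMem hz]
      simp only [Set.mem_pi, Set.mem_univ, true_implies, not_forall] at hz
      obtain ⟨i, hi⟩ := hz
      rw [Finset.prod_eq_zero (Finset.mem_univ i) (Set.indicator_of_notMem hi _)]
      simp
  simp_rw [h1]
  rw [lint_prod _ (fun i => (integrable_gaussianPDFReal 0 1).indicator (hs i))
    (fun i x => Set.indicator_nonneg (fun _ _ => gaussianPDFReal_nonneg _ _ _) _)]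
  refine Finset.prod_congr rfl fun i _ => ?_
  rw [integral_indicator (hs i), gaussianReal_apply_eq_integral _ one_ne_zero]

lemma gd_lint {n : ℕ} (a : Fin n → ℝ) : ∫⁻ y, ENNReal.ofReal (gd (y - a)) = 1 := by
  rw [lintegral_sub_right_eq_self (fun y => ENNReal.ofReal (gd y)) a]
  have := measure_univ (μ := MimoOptical.stdGaussian n)
  rw [std_density, withDensity_apply _ MeasurableSet.univ, Measure.restrict_univ] at this
  exact this

lemma measurable_mulVec' {n k : ℕ} (M : Matrix (Fin n) (Fin k) ℝ) : Measurable (fun x => M *ᵥ x) :=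
  (Continuous.matrix_mulVec continuous_const continuous_id).measurable

lemma joint_density {nt nr : ℕ} (H : Matrix (Fin nr) (Fin nt) ℝ) (μ : Measure (Fin nt → ℝ))
    [IsProbabilityMeasure μ] :
    jointLaw H μ = (μ.prod volume).withDensity (fun q => ENNReal.ofReal (gd (q.2 - H *ᵥ q.1))) := by
  have hH := measurable_mulVec' H
  have hg : Measurable fun z : Fin nr → ℝ => ENNReal.ofReal (gd z) := gd_measurable.ennreal_ofReal
  have hT : Measurable fun p : (Fin nt → ℝ) × (Fin nr → ℝ) => (p.1, H *ᵥ p.1 + p.2) :=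
    measurable_fst.prodMk ((hH.comp measurable_fst).add measurable_snd)
  have hg2 : Measurable fun q : (Fin nt → ℝ) × (Fin nr → ℝ) =>
      ENNReal.ofReal (gd (q.2 - H *ᵥ q.1)) :=
    hg.comp (measurable_snd.sub (hH.comp measurable_fst))
  refine Measure.ext_of_lintegral _ fun φ hφ => ?_
  have hφT : Measurable fun p : (Fin nt → ℝ) × (Fin nr → ℝ) => φ (p.1, H *ᵥ p.1 + p.2) :=
    hφ.comp hT
  rw [jointLaw, lintegral_map hφ hT,
    lintegral_withDensity_eq_lintegral_mul _ hg2 hφ, lintegral_prod _ hφT.aemeasurable,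
    lintegral_prod _ (hg2.mul hφ).aemeasurable]
  refine lintegral_congr fun x => ?_
  have hφx : Measurable fun z => φ (x, H *ᵥ x + z) := hφT.comp measurable_prodMk_left
  rw [std_density, lintegral_withDensity_eq_lintegral_mul _ hg hφx]
  rw [← lintegral_sub_right_eq_self _ (H *ᵥ x)]
  refine lintegral_congr fun y => ?_
  simp
end MimoAux

namespace MimoAux
open MimoOptical

/-- product density in the transformed coordinates -/
def GU {nt nr : ℕ} (H : Matrix (Fin nr) (Fin nt) ℝ) (A m : ℝ) (U : Finset (Fin nt))
    (t : Fin nr → ℝ) : ℝ :=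
  ∏ ℓ, (Real.exp (-phi (sigmaUl H U ℓ) A m (t ℓ)) / Real.sqrt (2 * Real.pi))
    / KK (sigmaUl H U ℓ) A m

/-- auxiliary output density attached to `U` -/
def RU {nt nr : ℕ} (H : Matrix (Fin nr) (Fin nt) ℝ) (A m : ℝ) (U : Finset (Fin nt))
    (y : Fin nr → ℝ) : ℝ :=
  |(HU H U).det|⁻¹ * GU H A m U ((HU H U)⁻¹ *ᵥ (y - vU H A U))

section
variable {nt nr : ℕ} {H : Matrix (Fin nr) (Fin nt) ℝ} {U : Finset (Fin nt)}
  (A m : ℝ)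

lemma det_pos (hU : U ∈ goodSets H) : 0 < |(HU H U).det| := abs_pos.2 (HU_det hU).ne_zero

lemma GU_fac_pos (hU : U ∈ goodSets H) (hA : 0 < A) (hm : 0 < m) (ℓ : Fin nr) (s : ℝ) :
    0 < (Real.exp (-phi (sigmaUl H U ℓ) A m s) / Real.sqrt (2 * Real.pi))
    / KK (sigmaUl H U ℓ) A m := by
  have := KK_pos (sigmaUl H U ℓ) A m (sigma_pos hU ℓ) hA hm
  positivity

lemma GU_pos (hU : U ∈ goodSets H) (hA : 0 < A) (hm : 0 < m) (t : Fin nr → ℝ) :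
    0 < GU H A m U t :=
  Finset.prod_pos fun ℓ _ => GU_fac_pos A m hU hA hm ℓ _

lemma GU_measurable : Measurable (GU H A m U) :=
  Finset.measurable_prod _ fun ℓ _ => ((Real.measurable_exp.comp
    ((measurable_phi _ A m).comp (measurable_pi_apply ℓ)).neg).div_const _).div_const _

lemma RU_measurable : Measurable (RU H A m U) :=
  ((GU_measurable A m).comp ((measurable_mulVec' _).comp (measurable_id.sub_const _))).const_mul _

lemma RU_pos (hU : U ∈ goodSets H) (hA : 0 < A) (hm : 0 < m) (y : Fin nr → ℝ) :
    0 < RU H A m U y :=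
  mul_pos (inv_pos.2 (det_pos hU)) (GU_pos A m hU hA hm _)

lemma GU_lint (hU : U ∈ goodSets H) (hA : 0 < A) (hm : 0 < m) :
    ∫⁻ t, ENNReal.ofReal (GU H A m U t) = 1 := by
  have hIntegr := fun ℓ : Fin nr => integral_phi (sigmaUl H U ℓ) A m (sigma_pos hU ℓ) hA hm
  unfold GU
  rw [lint_prod (fun ℓ s => (Real.exp (-phi (sigmaUl H U ℓ) A m s) / Real.sqrt (2 * Real.pi))
    / KK (sigmaUl H U ℓ) A m) (fun ℓ => (hIntegr ℓ).1.div_const _)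
    (fun ℓ s => (GU_fac_pos A m hU hA hm ℓ s).le)]
  refine Finset.prod_eq_one fun ℓ _ => ?_
  rw [integral_div, (hIntegr ℓ).2,
    div_self (KK_pos (sigmaUl H U ℓ) A m (sigma_pos hU ℓ) hA hm).ne', ENNReal.ofReal_one]

lemma RU_lint (hU : U ∈ goodSets H) (hA : 0 < A) (hm : 0 < m) :
    ∫⁻ y, ENNReal.ofReal (RU H A m U y) = 1 := by
  have hd := HU_det hU
  have hG : Measurable fun t => ENNReal.ofReal (GU H A m U t) :=
    (GU_measurable A m).ennreal_ofReal
  have h1 : ∀ y, ENNReal.ofReal (RU H A m U y) = ENNReal.ofReal (|(HU H U).det|⁻¹) *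
      ENNReal.ofReal (GU H A m U ((HU H U)⁻¹ *ᵥ (y - vU H A U))) := fun y => by
    rw [RU, ENNReal.ofReal_mul (by positivity)]
  simp_rw [h1]
  rw [lintegral_sub_right_eq_self (fun y => ENNReal.ofReal (|(HU H U).det|⁻¹) *
      ENNReal.ofReal (GU H A m U ((HU H U)⁻¹ *ᵥ y))) (vU H A U)]
  have hGM : Measurable fun y => ENNReal.ofReal (GU H A m U ((HU H U)⁻¹ *ᵥ y)) :=
    hG.comp (measurable_mulVec' _)
  rw [lintegral_const_mul _ hGM]
  have hd2 : ((HU H U)⁻¹).det ≠ 0 := by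
    rw [Matrix.det_nonsing_inv]
    simpa using hd.ne_zero
  have h2 := Real.map_matrix_volume_pi_eq_smul_volume_pi hd2
  have h3 : ∫⁻ y, ENNReal.ofReal (GU H A m U ((HU H U)⁻¹ *ᵥ y))
      = ∫⁻ t, ENNReal.ofReal (GU H A m U t)
        ∂(Measure.map (Matrix.toLin' ((HU H U)⁻¹)) volume) := by
    rw [lintegral_map hG (by exact measurable_mulVec' _)]
    rfl
  rw [h3, h2, lintegral_smul_measure, GU_lint A m hU hA hm, Matrix.det_nonsing_inv,
    Ring.inverse_eq_inv', inv_inv, smul_eq_mul, mul_one, ← ENNReal.ofReal_mul (by positivity),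
    inv_mul_cancel₀ (det_pos hU).ne', ENNReal.ofReal_one]

lemma RU_log (hU : U ∈ goodSets H) (hA : 0 < A) (hm : 0 < m) (x : Fin nt → ℝ) (z : Fin nr → ℝ) :
    Real.log (RU H A m U (H *ᵥ x + z)) = - Real.log |(HU H U).det|
      - ∑ ℓ, phi (sigmaUl H U ℓ) A m (lamU H A U x ℓ + ((HU H U)⁻¹ *ᵥ z) ℓ)
      - nr * Real.log (Real.sqrt (2 * Real.pi)) - ∑ ℓ, Real.log (KK (sigmaUl H U ℓ) A m) := by
  have hv : (HU H U)⁻¹ *ᵥ (H *ᵥ x + z - vU H A U) = lamU H A U x + (HU H U)⁻¹ *ᵥ z := by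
    rw [lamU, ← Matrix.mulVec_add]
    congr 1
    abel
  rw [RU, Real.log_mul (inv_pos.2 (det_pos hU)).ne' (GU_pos A m hU hA hm _).ne', Real.log_inv, GU,
    Real.log_prod (fun ℓ _ => (GU_fac_pos A m hU hA hm ℓ _).ne'), hv]
  have : ∀ ℓ s, Real.log ((Real.exp (-phi (sigmaUl H U ℓ) A m s) / Real.sqrt (2 * Real.pi))
    / KK (sigmaUl H U ℓ) A m) = - phi (sigmaUl H U ℓ) A m s - Real.log (Real.sqrt (2 * Real.pi))
      - Real.log (KK (sigmaUl H U ℓ) A m) := by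
    intro ℓ s
    rw [Real.log_div (by positivity) (KK_pos _ A m (sigma_pos hU ℓ) hA hm).ne',
      Real.log_div (by positivity) (by positivity), Real.log_exp]
  simp only [this, Finset.sum_sub_distrib, Finset.sum_neg_distrib, Pi.add_apply,
    Finset.sum_const, Finset.card_univ, Fintype.card_fin, nsmul_eq_mul]
  ring

lemma cauchy_row (hU : U ∈ goodSets H) (ℓ : Fin nr) (z : Fin nr → ℝ) :
    ((HU H U)⁻¹ *ᵥ z) ℓ ^ 2 / (2 * sigmaUl H U ℓ ^ 2) ≤ (∑ i, z i ^ 2) / 2 := by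
  have hs := sigma_pos hU ℓ
  rw [div_le_div_iff₀ (by positivity) (by norm_num)]
  have h := Finset.sum_mul_sq_le_sq_mul_sq Finset.univ ((HU H U)⁻¹ ℓ) z
  rw [← sigma_sq H U ℓ] at h
  have e : ((HU H U)⁻¹ *ᵥ z) ℓ = ∑ i, (HU H U)⁻¹ ℓ i * z i := rfl
  rw [e]
  linarith

end

section selection
variable {X ι : Type*} [MeasurableSpace X] [Fintype ι]

lemma selection [DecidableEq ι] (g : Finset ι) (U0 : ι) (hU0 : U0 ∈ g) (E : ι → Set X) (hE : ∀ U, MeasurableSet (E U)) :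
    ∃ f : X → ι, (∀ U, MeasurableSet (f ⁻¹' {U})) ∧ (∀ x, f x ∈ g) ∧
      ∀ x, (∃ U ∈ g, x ∈ E U) → x ∈ E (f x) := by
  classical
  suffices h : ∀ s : Finset ι, s ⊆ g → ∃ f : X → ι, (∀ U, MeasurableSet (f ⁻¹' {U})) ∧
      (∀ x, f x ∈ g) ∧ ∀ x, (∃ U ∈ s, x ∈ E U) → x ∈ E (f x) from h g subset_rfl
  intro s
  induction s using Finset.induction_on with
  | empty =>
    intro _
    refine ⟨fun _ => U0, fun U => ?_, fun _ => hU0, fun x hx => ?_⟩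
    · exact MeasurableSet.const (U0 ∈ ({U} : Set ι))
    · simp at hx
  | insert a s _ ih =>
    intro hs
    obtain ⟨f, hf1, hf2, hf3⟩ := ih ((Finset.subset_insert a s).trans hs)
    refine ⟨fun x => if x ∈ E a then a else f x, fun U => ?_, fun x => ?_, fun x hx => ?_⟩
    · have : (fun x => if x ∈ E a then a else f x) ⁻¹' {U}
          = (E a ∩ {_x | a = U}) ∪ ((E a)ᶜ ∩ f ⁻¹' {U}) := by
        ext x
        by_cases h : x ∈ E a <;> simp [h]
      rw [this]
      exact ((hE a).inter (MeasurableSet.const _)).union ((hE a).compl.inter (hf1 U))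
    · dsimp only
      split_ifs
      · exact hs (Finset.mem_insert_self a s)
      · exact hf2 x
    · dsimp only
      split_ifs with h
      · exact h
      · refine hf3 x ?_
        obtain ⟨U, hU, hxU⟩ := hx
        rcases Finset.mem_insert.1 hU with rfl | h'
        · exact absurd hxU h
        · exact ⟨U, h', hxU⟩

lemma fiber_measurable (f : X → ι) (hf : ∀ U, MeasurableSet (f ⁻¹' {U})) {Y : Type*}
    [MeasurableSpace Y] (r : Y → X) (hr : Measurable r)
    (K : ι → Y → ℝ) (hK : ∀ U, Measurable (K U)) : Measurable fun y => K (f (r y)) y := by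
  classical
  have : (fun y => K (f (r y)) y)
      = fun y => ∑ U, (r ⁻¹' (f ⁻¹' {U})).indicator (K U) y := by
    ext y
    rw [Finset.sum_eq_single (f (r y))]
    · rw [Set.indicator_of_mem]; simp
    · intro U _ hU
      rw [Set.indicator_of_notMem]; simpa using hU.symm
    · simp
  rw [this]
  exact Finset.measurable_sum _ fun U _ => (hK U).indicator (hr (hf U))

lemma fiber_integral (μ : Measure X) [IsProbabilityMeasure μ] (f : X → ι)
    (hf : ∀ U, MeasurableSet (f ⁻¹' {U})) (G : ι → ℝ) :
    Integrable (fun x => G (f x)) μ ∧ ∫ x, G (f x) ∂μ = ∑ U, μ.real (f ⁻¹' {U}) * G U := by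
  classical
  have : (fun x => G (f x))
      = fun x => ∑ U, (f ⁻¹' {U}).indicator (fun _ => G U) x := by
    ext x
    rw [Finset.sum_eq_single (f x)]
    · rw [Set.indicator_of_mem]; simp
    · intro U _ hU
      rw [Set.indicator_of_notMem]; simpa using hU.symm
    · simp
  have hi : ∀ U, Integrable ((f ⁻¹' {U}).indicator fun _ => G U) μ := fun U =>
    (integrable_const _).indicator (hf U)
  rw [this]
  refine ⟨integrable_finsetSum _ fun U _ => hi U, ?_⟩
  rw [integral_finsetSum _ fun U _ => hi U]
  refine Finset.sum_congr rfl fun U _ => ?_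
  rw [integral_indicator_const _ (hf U), smul_eq_mul]

lemma fiber_pos (μ : Measure X) [IsProbabilityMeasure μ] (f : X → ι) :
    ∀ᵐ x ∂μ, 0 < μ.real (f ⁻¹' {f x}) := by
  have : ∀ᵐ x ∂μ, ∀ U, f x = U → 0 < μ.real (f ⁻¹' {U}) := by
    rw [ae_all_iff]
    intro U
    by_cases h : 0 < μ.real (f ⁻¹' {U})
    · exact ae_of_all _ fun _ _ => h
    · have h0 : μ (f ⁻¹' {U}) = 0 := by
        have := le_antisymm (not_lt.1 h) measureReal_nonneg
        rwa [measureReal_eq_zero_iff] at this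
      have := measure_eq_zero_iff_ae_notMem.1 h0
      filter_upwards [this] with x hx hxU
      exact absurd hxU hx
  filter_upwards [this] with x hx using hx _ rfl
end selection
end MimoAux

namespace MimoAux
open MimoOptical

/-- the part of the bound attached to `U` not depending on the power -/
def CU {nt nr : ℕ} (H : Matrix (Fin nr) (Fin nt) ℝ) (A m : ℝ) (p : Finset (Fin nt) → ℝ)
    (U : Finset (Fin nt)) : ℝ :=
  -Real.log (p U) + Real.log |(HU H U).det| + ∑ ℓ, Real.log (KK (sigmaUl H U ℓ) A m)

/-- the log-density ratio in the coordinates `(x, z)` for fixed `U` -/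
def BU {nt nr : ℕ} (H : Matrix (Fin nr) (Fin nt) ℝ) (A m : ℝ) (p : Finset (Fin nt) → ℝ)
    (U : Finset (Fin nt)) (q : (Fin nt → ℝ) × (Fin nr → ℝ)) : ℝ :=
  CU H A m p U + ∑ ℓ, phi (sigmaUl H U ℓ) A m (lamU H A U q.1 ℓ + ((HU H U)⁻¹ *ᵥ q.2) ℓ)
    - (∑ i, q.2 i ^ 2) / 2

/-- the noise contribution -/
def NU {nt nr : ℕ} (H : Matrix (Fin nr) (Fin nt) ℝ) (A m : ℝ) (U : Finset (Fin nt)) : ℝ :=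
  m / (A * Real.sqrt (2 * Real.pi)) * ∑ ℓ, sigmaUl H U ℓ *
    (1 - Real.exp (-(A ^ 2) / (2 * sigmaUl H U ℓ ^ 2)))

section
variable {nt nr : ℕ} (H : Matrix (Fin nr) (Fin nt) ℝ) (A m : ℝ) (p : Finset (Fin nt) → ℝ)

lemma lamU_measurable (U : Finset (Fin nt)) : Measurable (lamU H A U) :=
  (measurable_mulVec' _).comp ((measurable_mulVec' H).sub_const _)

lemma BU_measurable (U : Finset (Fin nt)) : Measurable (BU H A m p U) := by
  unfold BU
  refine (measurable_const.add (Finset.measurable_sum _ fun ℓ _ => ?_)).sub ?_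
  · refine (measurable_phi _ A m).comp (Measurable.add ?_ ?_)
    · exact (measurable_pi_apply ℓ).comp ((lamU_measurable H A U).comp measurable_fst)
    · exact (measurable_pi_apply ℓ).comp ((measurable_mulVec' _).comp measurable_snd)
  · exact (Finset.measurable_sum _ fun i _ =>
      ((measurable_pi_apply i).comp measurable_snd).pow_const 2).div_const _

lemma phi_bound {U : Finset (Fin nt)} (hU : U ∈ goodSets H) (hA : 0 < A) (hm : 0 < m)
    (l : ℝ) (hl : l ∈ Set.Icc 0 A) (ℓ : Fin nr) (z : Fin nr → ℝ) :
    phi (sigmaUl H U ℓ) A m (l + ((HU H U)⁻¹ *ᵥ z) ℓ) ≤ 1 / 2 + m + (∑ i, z i ^ 2) / 2 :=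
  (phi_le _ A m l _ hA hm hl).trans (by linarith [cauchy_row hU ℓ z])

lemma std_sum_sq (n : ℕ) : Integrable (fun z : Fin n → ℝ => (∑ i, z i ^ 2) / 2)
      (MimoOptical.stdGaussian n) ∧
    ∫ z, (∑ i, z i ^ 2) / 2 ∂(MimoOptical.stdGaussian n) = n / 2 := by
  refine ⟨(integrable_finsetSum _ fun i _ => std_int_sq n i).div_const 2, ?_⟩
  rw [integral_div, integral_finsetSum _ fun i _ => std_int_sq n i]
  simp [std_integral_sq]

lemma phi_int {U : Finset (Fin nt)} (hU : U ∈ goodSets H) (hA : 0 < A) (hm : 0 < m)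
    (l : ℝ) (hl : l ∈ Set.Icc 0 A) (ℓ : Fin nr) :
    Integrable (fun z => phi (sigmaUl H U ℓ) A m (l + ((HU H U)⁻¹ *ᵥ z) ℓ))
      (MimoOptical.stdGaussian nr) := by
  refine ((integrable_const (1 / 2 + m)).add (std_sum_sq nr).1).mono' ?_ (ae_of_all _ fun z => ?_)
  · exact ((measurable_phi _ A m).comp (Measurable.add measurable_const
      ((measurable_pi_apply ℓ).comp (measurable_mulVec' _)))).aestronglyMeasurable
  · rw [Real.norm_of_nonneg (phi_nonneg _ A m _ hA hm)]
    exact phi_bound H A m hU hA hm l hl ℓ z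

lemma BU_inner {U : Finset (Fin nt)} (hU : U ∈ goodSets H) (hA : 0 < A) (hm : 0 < m)
    (x : Fin nt → ℝ) (hl : ∀ ℓ, lamU H A U x ℓ ∈ Set.Icc 0 A)
    (hs : A * sU H U + ∑ ℓ, lamU H A U x ℓ ≤ ∑ k, x k) :
    ∫ z, BU H A m p U (x, z) ∂(MimoOptical.stdGaussian nr) ≤
      (CU H A m p U + NU H A m U - m * sU H U) + m / A * ∑ k, x k := by
  unfold BU
  have hi : Integrable (fun z : Fin nr → ℝ =>
      ∑ ℓ, phi (sigmaUl H U ℓ) A m (lamU H A U x ℓ + ((HU H U)⁻¹ *ᵥ z) ℓ))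
      (MimoOptical.stdGaussian nr) :=
    integrable_finsetSum _ fun ℓ _ => phi_int H A m hU hA hm _ (hl ℓ) ℓ
  have hi1 : Integrable (fun z : Fin nr → ℝ => CU H A m p U +
      ∑ ℓ, phi (sigmaUl H U ℓ) A m (lamU H A U x ℓ + ((HU H U)⁻¹ *ᵥ z) ℓ))
      (MimoOptical.stdGaussian nr) := (integrable_const _).add hi
  rw [integral_sub hi1 (std_sum_sq nr).1, integral_add (integrable_const _) hi, (std_sum_sq nr).2,
    integral_finsetSum _ fun ℓ _ => phi_int H A m hU hA hm _ (hl ℓ) ℓ]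
  have h1 := Finset.sum_le_sum fun ℓ (_ : ℓ ∈ Finset.univ) =>
    phi_expect_vec hU A m _ hA hm (hl ℓ) ℓ
  have h2 : ∑ ℓ : Fin nr, (1 / 2 + m / A * (lamU H A U x ℓ + sigmaUl H U ℓ / Real.sqrt (2 * Real.pi) *
        (1 - Real.exp (-(A ^ 2) / (2 * sigmaUl H U ℓ ^ 2)))))
      = nr / 2 + m / A * ∑ ℓ, lamU H A U x ℓ + NU H A m U := by
    rw [NU, Finset.sum_add_distrib, ← Finset.mul_sum, Finset.sum_add_distrib, mul_add, add_assoc]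
    congr 1
    · simp; ring
    · congr 1
      rw [Finset.mul_sum, Finset.mul_sum]
      refine Finset.sum_congr rfl fun ℓ _ => ?_
      field_simp
  rw [h2] at h1
  have h3 : m / A * (A * sU H U + ∑ ℓ, lamU H A U x ℓ) ≤ m / A * ∑ k, x k :=
    mul_le_mul_of_nonneg_left hs (by positivity)
  have h4 : m / A * (A * sU H U) = m * sU H U := by field_simp
  simp only [integral_const, probReal_univ, one_smul]
  rw [mul_add, h4] at h3
  linarith

set_option maxHeartbeats 1000000 in
theorem bound_m (hA : 0 < A) (hm : 0 < m) (α : ℝ) (μ : Measure (Fin nt → ℝ))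
    [IsProbabilityMeasure μ] (hcube : ∀ᵐ x ∂μ, ∀ k, x k ∈ Set.Icc (0 : ℝ) A)
    (hpow : (∫ x, ∑ k, |x k| ∂μ) ≤ α * A)
    (f : (Fin nt → ℝ) → Finset (Fin nt)) (hf : ∀ U, MeasurableSet (f ⁻¹' {U}))
    (hfg : ∀ x, f x ∈ goodSets H)
    (hfx : ∀ x, (∀ k, x k ∈ Set.Icc (0 : ℝ) A) → (∀ ℓ, lamU H A (f x) x ℓ ∈ Set.Icc 0 A) ∧
      A * sU H (f x) + ∑ ℓ, lamU H A (f x) x ℓ ≤ ∑ k, x k)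
    (hp : p = fun U => μ.real (f ⁻¹' {U})) :
    (∑ U, p U * sU H U ≤ α) ∧ mutualInfoJoint (jointLaw H μ) ≤
      ∑ U, p U * (CU H A m p U + NU H A m U - m * sU H U) + m * α := by
  classical
  have hxint : Integrable (fun x : Fin nt → ℝ => ∑ k, x k) μ := by
    refine integrable_finsetSum _ fun k _ => ?_
    refine (integrable_const A).mono' (measurable_pi_apply k).aestronglyMeasurable ?_
    filter_upwards [hcube] with x hx
    rw [Real.norm_of_nonneg (hx k).1]
    exact (hx k).2
  have hpow2 : ∫ x, ∑ k, x k ∂μ ≤ α * A := by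
    refine le_trans (le_of_eq (integral_congr_ae ?_)) hpow
    filter_upwards [hcube] with x hx
    exact Finset.sum_congr rfl fun k _ => (abs_of_nonneg (hx k).1).symm
  have hfi := fiber_integral μ f hf
  constructor
  · have h1 := hfi (fun U => A * sU H U)
    have h2 : ∫ x, A * sU H (f x) ∂μ ≤ ∫ x, ∑ k, x k ∂μ := by
      refine integral_mono_ae h1.1 hxint ?_
      filter_upwards [hcube] with x hx
      obtain ⟨h3, h4⟩ := hfx x hx
      have := Finset.sum_nonneg fun ℓ (_ : ℓ ∈ Finset.univ) => (h3 ℓ).1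
      linarith
    rw [h1.2] at h2
    have h3 : ∑ U, μ.real (f ⁻¹' {U}) * (A * sU H U) = (∑ U, p U * sU H U) * A := by
      rw [hp, Finset.sum_mul]
      exact Finset.sum_congr rfl fun U _ => by ring
    rw [h3] at h2
    exact le_of_mul_le_mul_right (h2.trans hpow2) hA
  · have hpos : ∀ᵐ x ∂μ, 0 < p (f x) := by
      rw [hp]; exact fiber_pos μ f
    have hH := measurable_mulVec' H
    have hT : Measurable fun q : (Fin nt → ℝ) × (Fin nr → ℝ) => (q.1, H *ᵥ q.1 + q.2) :=
      measurable_fst.prodMk ((hH.comp measurable_fst).add measurable_snd)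
    set w : (Fin nt → ℝ) × (Fin nr → ℝ) → ℝ := fun q => gd (q.2 - H *ᵥ q.1) with hw
    have hwm : Measurable w := gd_measurable.comp (measurable_snd.sub (hH.comp measurable_fst))
    set S : (Fin nt → ℝ) × (Fin nr → ℝ) → ℝ := fun q => p (f q.1) * RU H A m (f q.1) q.2 with hS
    have hSm : Measurable S := by
      exact fiber_measurable f hf Prod.fst measurable_fst (fun U q => p U * RU H A m U q.2)
        fun U => ((RU_measurable A m).comp measurable_snd).const_mul _
    have hp0 : ∀ U, 0 ≤ p U := fun U => by rw [hp]; exact measureReal_nonneg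
    have hpsum : ∑ U, p U = 1 := by
      have := (hfi fun _ => 1).2
      simp at this
      rw [hp]; exact this.symm
    have hpbad : ∀ U, U ∉ goodSets H → p U = 0 := by
      intro U hU
      have : f ⁻¹' {U} = ∅ := by
        ext x; simp; rintro rfl; exact hU (hfg x)
      rw [hp]; simp [this]
    set R : (Fin nr → ℝ) → ℝ := fun y => ∑ U, p U * RU H A m U y with hR
    have hRm : Measurable R := Finset.measurable_sum _ fun U _ => (RU_measurable A m).const_mul _
    have hterm : ∀ U y, 0 ≤ p U * RU H A m U y := by
      intro U y
      by_cases hU : U ∈ goodSets H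
      · exact mul_nonneg (hp0 U) (RU_pos A m hU hA hm y).le
      · rw [hpbad U hU, zero_mul]
    have hSR : ∀ q, S q ≤ R q.2 := fun q =>
      Finset.single_le_sum (f := fun U => p U * RU H A m U q.2) (fun U _ => hterm U q.2)
        (Finset.mem_univ (f q.1))
    have hR1 : ∫⁻ y, ENNReal.ofReal (R y) ≤ 1 := by
      simp only [hR]
      have e : ∀ y, ENNReal.ofReal (∑ U, p U * RU H A m U y)
          = ∑ U, ENNReal.ofReal (p U) * ENNReal.ofReal (RU H A m U y) := by
        intro y
        rw [ENNReal.ofReal_sum_of_nonneg fun U _ => hterm U y]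
        exact Finset.sum_congr rfl fun U _ => ENNReal.ofReal_mul (hp0 U)
      simp_rw [e]
      rw [lintegral_finsetSum _ fun U _ => (RU_measurable A m).ennreal_ofReal.const_mul _]
      have e2 : ∀ U, ∫⁻ y, ENNReal.ofReal (p U) * ENNReal.ofReal (RU H A m U y)
          = ENNReal.ofReal (p U) := by
        intro U
        rw [lintegral_const_mul _ (RU_measurable A m).ennreal_ofReal]
        by_cases hU : U ∈ goodSets H
        · rw [RU_lint A m hU hA hm, mul_one]
        · rw [hpbad U hU]; simp
      simp_rw [e2]
      rw [← ENNReal.ofReal_sum_of_nonneg fun U _ => hp0 U, hpsum, ENNReal.ofReal_one]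
    set B : (Fin nt → ℝ) × (Fin nr → ℝ) → ℝ := fun q => BU H A m p (f q.1) q with hB
    have hBm : Measurable B :=
      fiber_measurable f hf Prod.fst measurable_fst (BU H A m p) (BU_measurable H A m p)
    have hpos2 : ∀ᵐ q ∂(μ.prod (MimoOptical.stdGaussian nr)), 0 < p (f q.1) :=
      Measure.quasiMeasurePreserving_fst.ae hpos
    have hcube2 : ∀ᵐ q ∂(μ.prod (MimoOptical.stdGaussian nr)), ∀ k, q.1 k ∈ Set.Icc (0 : ℝ) A :=
      Measure.quasiMeasurePreserving_fst.ae hcube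
    have hBint : Integrable B (μ.prod (MimoOptical.stdGaussian nr)) := by
      have hz : Integrable (fun q : (Fin nt → ℝ) × (Fin nr → ℝ) => (∑ i, q.2 i ^ 2) / 2)
          (μ.prod (MimoOptical.stdGaussian nr)) := (std_sum_sq nr).1.comp_snd μ
      have hbd : Integrable (fun q : (Fin nt → ℝ) × (Fin nr → ℝ) =>
          ((∑ U, |CU H A m p U|) + (nr : ℝ) * (1 / 2 + m)) + ((nr : ℝ) + 1) * ((∑ i, q.2 i ^ 2) / 2))
          (μ.prod (MimoOptical.stdGaussian nr)) := (integrable_const _).add (hz.const_mul _)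
      refine hbd.mono' hBm.aestronglyMeasurable ?_
      filter_upwards [hcube2] with q hq
      obtain ⟨hl, -⟩ := hfx q.1 hq
      have h1 : |CU H A m p (f q.1)| ≤ ∑ U, |CU H A m p U| :=
        Finset.single_le_sum (f := fun U => |CU H A m p U|) (fun U _ => abs_nonneg _)
          (Finset.mem_univ (f q.1))
      have h2 : ∑ ℓ, phi (sigmaUl H (f q.1) ℓ) A m
          (lamU H A (f q.1) q.1 ℓ + ((HU H (f q.1))⁻¹ *ᵥ q.2) ℓ)
          ≤ ∑ _ℓ : Fin nr, (1 / 2 + m + (∑ i, q.2 i ^ 2) / 2) :=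
        Finset.sum_le_sum fun ℓ _ => phi_bound H A m (hfg q.1) hA hm _ (hl ℓ) ℓ q.2
      have h3 : 0 ≤ ∑ ℓ, phi (sigmaUl H (f q.1) ℓ) A m
          (lamU H A (f q.1) q.1 ℓ + ((HU H (f q.1))⁻¹ *ᵥ q.2) ℓ) :=
        Finset.sum_nonneg fun ℓ _ => phi_nonneg _ A m _ hA hm
      have h4 : 0 ≤ ∑ i, q.2 i ^ 2 := Finset.sum_nonneg fun i _ => sq_nonneg _
      simp only [Finset.sum_const, Finset.card_univ, Fintype.card_fin, nsmul_eq_mul] at h2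
      have h5 := abs_le.1 h1
      have h6 : 0 ≤ (nr : ℝ) * (1 / 2 + m) := by positivity
      have h7 : 0 ≤ (nr : ℝ) * ((∑ i, q.2 i ^ 2) / 2) := by positivity
      rw [Real.norm_eq_abs, abs_le]
      simp only [hB, BU]
      constructor <;> nlinarith
    have hbB : ∀ᵐ q ∂(μ.prod (MimoOptical.stdGaussian nr)),
        Real.log (w (q.1, H *ᵥ q.1 + q.2)) - Real.log (S (q.1, H *ᵥ q.1 + q.2)) = B q := by
      filter_upwards [hpos2] with q hq
      simp only [hw, hS, hB, BU, CU]
      rw [add_sub_cancel_left, gd_log,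
        Real.log_mul hq.ne' (RU_pos A m (hfg q.1) hA hm _).ne', RU_log A m (hfg q.1) hA hm]
      ring
    have hlm : Measurable fun q => Real.log (w q) - Real.log (S q) :=
      (Real.measurable_log.comp hwm).sub (Real.measurable_log.comp hSm)
    have hb : Integrable (fun q => Real.log (w q) - Real.log (S q)) (jointLaw H μ) := by
      unfold jointLaw
      rw [integrable_map_measure hlm.aestronglyMeasurable hT.aemeasurable]
      exact hBint.congr (hbB.mono fun q hq => hq.symm)
    have hSpos : ∀ᵐ q ∂(jointLaw H μ), 0 < S q := by
      unfold jointLaw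
      rw [ae_map_iff hT.aemeasurable (measurableSet_lt measurable_const hSm)]
      filter_upwards [hpos2] with q hq
      exact mul_pos hq (RU_pos A m (hfg q.1) hA hm _)
    have hw1 : ∀ x, ∫⁻ y, ENNReal.ofReal (w (x, y)) = 1 := fun x => gd_lint (H *ᵥ x)
    have hwpos : ∀ q, 0 < w q := fun q => gd_pos (q.2 - H *ᵥ q.1)
    refine (duality μ volume w hwm hwpos hw1 S R hRm hSR hR1
      (jointLaw H μ) (joint_density H μ) hSpos hb).trans ?_
    have hI : ∫ q, (Real.log (w q) - Real.log (S q)) ∂(jointLaw H μ)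
        = ∫ x, ∫ z, B (x, z) ∂(MimoOptical.stdGaussian nr) ∂μ := by
      unfold jointLaw
      rw [integral_map hT.aemeasurable hlm.aestronglyMeasurable, integral_congr_ae hbB,
        integral_prod _ hBint]
    rw [hI]
    have hG := hfi (fun U => CU H A m p U + NU H A m U - m * sU H U)
    have hfin : ∫ x, ∫ z, B (x, z) ∂(MimoOptical.stdGaussian nr) ∂μ ≤
        ∫ x, ((CU H A m p (f x) + NU H A m (f x) - m * sU H (f x)) + m / A * ∑ k, x k) ∂μ := by
      refine integral_mono_ae hBint.integral_prod_left (hG.1.add (hxint.const_mul _)) ?_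
      filter_upwards [hcube] with x hx
      obtain ⟨h3, h4⟩ := hfx x hx
      exact BU_inner H A m p (hfg x) hA hm x h3 h4
    refine hfin.trans ?_
    rw [integral_add hG.1 (hxint.const_mul _), hG.2, integral_const_mul]
    have h5 : m / A * ∫ x, ∑ k, x k ∂μ ≤ m / A * (α * A) :=
      mul_le_mul_of_nonneg_left hpow2 (by positivity)
    have h6 : m / A * (α * A) = m * α := by field_simp
    rw [h6] at h5
    rw [hp] at *
    linarith
end
end MimoAux

namespace MimoAux
open MimoOptical

lemma finsum_good {ι : Type*} [Fintype ι] (S : Set ι) (F : ι → ℝ) (h : ∀ U, U ∉ S → F U = 0) :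
    ∑ᶠ U ∈ S, F U = ∑ U, F U := by
  rw [← finsum_eq_sum_of_fintype]
  refine finsum_congr fun U => ?_
  by_cases hU : U ∈ S
  · simp [hU]
  · simp [hU, h U hU]

lemma VH_pos {nt nr : ℕ} (H : Matrix (Fin nr) (Fin nt) ℝ) {U0 : Finset (Fin nt)}
    (hU0 : U0 ∈ goodSets H) : 0 < VH H := by
  classical
  have h1 : VH H = ∑ᶠ U ∈ goodSets H, (if U ∈ goodSets H then |(HU H U).det| else 0) := by
    unfold VH
    refine finsum_congr fun U => finsum_congr fun hU => ?_
    rw [if_pos hU]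
  rw [h1, finsum_good _ _ (fun U hU => if_neg hU)]
  refine Finset.sum_pos' (fun U _ => ?_) ⟨U0, Finset.mem_univ _, ?_⟩
  · split_ifs
    · exact abs_nonneg _
    · exact le_rfl
  · rw [if_pos hU0]; exact det_pos hU0

/-- the expression inside the infimum of the bound -/
def rhs {nt nr : ℕ} (H : Matrix (Fin nr) (Fin nt) ℝ) (A α : ℝ) (p : Finset (Fin nt) → ℝ)
    (mu : ℝ) : ℝ :=
  Real.log (MimoOptical.VH H) - MimoOptical.Dkl H p (MimoOptical.qU H)
            + (∑ᶠ U ∈ MimoOptical.goodSets H, p U *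
                ∑ ℓ, Real.log (MimoOptical.sigmaUl H U ℓ
                  + A / Real.sqrt (2 * Real.pi * Real.exp 1)
                    * ((1 - Real.exp (-mu)) / mu)))
            + mu / (A * Real.sqrt (2 * Real.pi)) *
                (∑ᶠ U ∈ MimoOptical.goodSets H, p U *
                  ∑ ℓ, MimoOptical.sigmaUl H U ℓ *
                    (1 - Real.exp (-(A ^ 2) / (2 * (MimoOptical.sigmaUl H U ℓ) ^ 2))))
            + mu * (α - ∑ᶠ U ∈ MimoOptical.goodSets H, p U * MimoOptical.sU H U)

lemma rhs_eq {nt nr : ℕ} (H : Matrix (Fin nr) (Fin nt) ℝ) (A α : ℝ) (p : Finset (Fin nt) → ℝ)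
    (mu : ℝ) (hp : ProbVec H p) {U0 : Finset (Fin nt)} (hU0 : U0 ∈ goodSets H) :
    rhs H A α p mu = ∑ U, p U * (CU H A mu p U + NU H A mu U - mu * sU H U) + mu * α := by
  obtain ⟨hp0, hpb, hps⟩ := hp
  have hV := VH_pos H hU0
  rw [finsum_good _ _ hpb] at hps
  unfold rhs Dkl
  rw [finsum_good _ _ (fun U hU => by rw [hpb U hU, zero_mul]),
    finsum_good _ _ (fun U hU => by rw [hpb U hU, zero_mul]),
    finsum_good _ _ (fun U hU => by rw [hpb U hU, zero_mul]),
    finsum_good _ _ (fun U hU => by rw [hpb U hU, zero_mul])]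
  have h1 : ∑ U, p U * Real.log (p U / qU H U)
      = ∑ U, p U * (Real.log (p U) - Real.log |(HU H U).det|) + Real.log (VH H) := by
    have : Real.log (VH H) = ∑ U, p U * Real.log (VH H) := by
      rw [← Finset.sum_mul, hps, one_mul]
    rw [this, ← Finset.sum_add_distrib]
    refine Finset.sum_congr rfl fun U _ => ?_
    by_cases hU : U ∈ goodSets H
    · rcases (hp0 U).eq_or_lt with h | h
      · simp [← h]
      · have hd := det_pos hU
        rw [qU, Real.log_div h.ne' (by positivity), Real.log_div hd.ne' hV.ne']
        ring
    · simp [hpb U hU]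
  rw [h1]
  have h2 : ∀ U, p U * (CU H A mu p U + NU H A mu U - mu * sU H U)
      = - (p U * (Real.log (p U) - Real.log |(HU H U).det|))
        + p U * ∑ ℓ, Real.log (KK (sigmaUl H U ℓ) A mu)
        + mu / (A * Real.sqrt (2 * Real.pi)) * (p U * ∑ ℓ, MimoOptical.sigmaUl H U ℓ *
            (1 - Real.exp (-(A ^ 2) / (2 * (MimoOptical.sigmaUl H U ℓ) ^ 2))))
        - mu * (p U * sU H U) := by
    intro U
    rw [CU, NU]
    ring
  simp only [h2, Finset.sum_add_distrib, Finset.sum_sub_distrib, ← Finset.mul_sum,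
    Finset.sum_neg_distrib]
  simp only [KK]
  ring

lemma rhs_bdd {nt nr : ℕ} (H : Matrix (Fin nr) (Fin nt) ℝ) (A α : ℝ) {U0 : Finset (Fin nt)}
    (hU0 : U0 ∈ goodSets H) :
    ∃ M, ∀ p, ProbVec H p → rhs H A α p 1 ≤ M := by
  refine ⟨∑ U, (1 + |(Real.log |(HU H U).det| + ∑ ℓ, Real.log (KK (sigmaUl H U ℓ) A 1))
    + NU H A 1 U - 1 * sU H U|) + 1 * α, fun p hp => ?_⟩
  rw [rhs_eq H A α p 1 hp hU0]
  obtain ⟨hp0, hpb, hps⟩ := hp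
  rw [finsum_good _ _ hpb] at hps
  refine add_le_add (Finset.sum_le_sum fun U _ => ?_) le_rfl
  have hp1 : p U ≤ 1 := by
    rw [← hps]; exact Finset.single_le_sum (fun U _ => hp0 U) (Finset.mem_univ U)
  set D := (Real.log |(HU H U).det| + ∑ ℓ, Real.log (KK (sigmaUl H U ℓ) A 1))
    + NU H A 1 U - 1 * sU H U with hD
  have e : CU H A 1 p U + NU H A 1 U - 1 * sU H U = - Real.log (p U) + D := by
    rw [hD, CU]; ring
  rw [e, mul_add]
  have h1 : p U * -Real.log (p U) ≤ 1 := by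
    rcases (hp0 U).eq_or_lt with h | h
    · simp [← h]
    · have := Real.log_le_sub_one_of_pos (inv_pos.2 h)
      rw [Real.log_inv] at this
      have h2 := mul_le_mul_of_nonneg_left this h.le
      rw [mul_sub, mul_inv_cancel₀ h.ne'] at h2
      linarith
  have h2 : p U * D ≤ |D| := by
    calc p U * D ≤ p U * |D| := mul_le_mul_of_nonneg_left (le_abs_self D) (hp0 U)
      _ ≤ 1 * |D| := mul_le_mul_of_nonneg_right hp1 (abs_nonneg _)
      _ = |D| := one_mul _
  linarith

theorem main_bound {nt nr : ℕ} (H : Matrix (Fin nr) (Fin nt) ℝ) (hrank : H.rank = nr)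
    (A α : ℝ) (hA : 0 < A)
    (htie : ∀ U ∈ goodSets H, ∀ j ∉ U, aUj H U j ≠ 1)
    {U0 : Finset (Fin nt)} (hU0 : U0 ∈ goodSets H)
    (μ : Measure (Fin nt → ℝ)) (hμ : Admissible nt A (α * A) μ) :
    ∃ p, ProbVec H p ∧ (∑ᶠ U ∈ goodSets H, p U * sU H U) ≤ α ∧
      ∀ m, 0 < m → mutualInfoJoint (jointLaw H μ) ≤ rhs H A α p m := by
  classical
  obtain ⟨hprob, hcube, hpow⟩ := hμ
  set g : Finset (Finset (Fin nt)) := Finset.univ.filter (fun U => U ∈ goodSets H) with hg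
  have hgm : ∀ U, U ∈ g ↔ U ∈ goodSets H := fun U => by simp [hg]
  set E : Finset (Fin nt) → Set (Fin nt → ℝ) := fun U =>
    {x | (∀ ℓ, lamU H A U x ℓ ∈ Set.Icc 0 A) ∧ A * sU H U + ∑ ℓ, lamU H A U x ℓ ≤ ∑ k, x k} with hE
  have hEm : ∀ U, MeasurableSet (E U) := by
    intro U
    have hl : ∀ ℓ, Measurable fun x => lamU H A U x ℓ := fun ℓ =>
      (measurable_pi_apply ℓ).comp (lamU_measurable H A U)
    have h1 : MeasurableSet {x | ∀ ℓ, lamU H A U x ℓ ∈ Set.Icc 0 A} := by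
      rw [Set.ofPred_forall]
      exact MeasurableSet.iInter fun ℓ => hl ℓ measurableSet_Icc
    have h2 : MeasurableSet {x : Fin nt → ℝ | A * sU H U + ∑ ℓ, lamU H A U x ℓ ≤ ∑ k, x k} :=
      measurableSet_le (measurable_const.add (Finset.measurable_sum _ fun ℓ _ => hl ℓ))
        (Finset.measurable_sum _ fun k _ => measurable_pi_apply k)
    exact h1.inter h2
  obtain ⟨f, hf1, hf2, hf3⟩ := selection g U0 ((hgm U0).2 hU0) E hEm
  have hfg : ∀ x, f x ∈ goodSets H := fun x => (hgm _).1 (hf2 x)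
  have hfx : ∀ x, (∀ k, x k ∈ Set.Icc (0 : ℝ) A) → (∀ ℓ, lamU H A (f x) x ℓ ∈ Set.Icc 0 A) ∧
      A * sU H (f x) + ∑ ℓ, lamU H A (f x) x ℓ ≤ ∑ k, x k := by
    intro x hx
    refine hf3 x ?_
    obtain ⟨U, hU, h1, h2⟩ := geometry H hrank A htie x hx
    exact ⟨U, (hgm U).2 hU, h1, h2⟩
  set p : Finset (Fin nt) → ℝ := fun U => μ.real (f ⁻¹' {U}) with hp
  have hpb : ∀ U, U ∉ goodSets H → p U = 0 := by
    intro U hU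
    have : f ⁻¹' {U} = ∅ := by
      ext x; simp; rintro rfl; exact hU (hfg x)
    simp [hp, this]
  have hPV : ProbVec H p := by
    refine ⟨fun U => measureReal_nonneg, hpb, ?_⟩
    rw [finsum_good _ _ hpb]
    have := (fiber_integral μ f hf1 fun _ => 1).2
    simp at this
    exact this.symm
  have hbm := fun m hm => bound_m H A m p hA hm α μ hcube hpow f hf1 hfg hfx hp
  refine ⟨p, hPV, ?_, fun m hm => ?_⟩
  · rw [finsum_good _ _ (fun U hU => by rw [hpb U hU, zero_mul])]
    exact (hbm 1 one_pos).1
  · rw [rhs_eq H A α p m hPV hU0]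
    exact (hbm m hm).2

theorem final {nt nr : ℕ} (H : Matrix (Fin nr) (Fin nt) ℝ) (hrank : H.rank = nr)
    (A α : ℝ) (hA : 0 < A) (hα : 0 < α)
    (htie : ∀ U ∈ goodSets H, ∀ j ∉ U, aUj H U j ≠ 1) :
    capacity H A (α * A) ≤ sSup { c | ∃ p : Finset (Fin nt) → ℝ, ProbVec H p ∧
        (∑ᶠ U ∈ goodSets H, p U * sU H U) ≤ α ∧
        c = sInf { b | ∃ mu : ℝ, 0 < mu ∧ b = rhs H A α p mu } } := by
  obtain ⟨U0, hU0, -⟩ := geometry H hrank A htie 0 (fun k => by simp [hA.le])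
  obtain ⟨M, hM⟩ := rhs_bdd H A α hU0
  refine csSup_le ?_ ?_
  · refine ⟨_, Measure.dirac 0, ⟨inferInstance, ?_, ?_⟩, rfl⟩
    · rw [ae_dirac_eq]
      simp [hA.le]
    · rw [integral_dirac]
      simp
      positivity
  · rintro c ⟨μ, hμ, rfl⟩
    obtain ⟨p, hp, hps, hb⟩ := main_bound H hrank A α hA htie hU0 μ hμ
    have hbdd : BddAbove { c | ∃ p : Finset (Fin nt) → ℝ, ProbVec H p ∧
        (∑ᶠ U ∈ goodSets H, p U * sU H U) ≤ α ∧
        c = sInf { b | ∃ mu : ℝ, 0 < mu ∧ b = rhs H A α p mu } } := by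
      refine ⟨max 0 M, ?_⟩
      rintro c ⟨p, hp, -, rfl⟩
      by_cases hbb : BddBelow { b | ∃ mu : ℝ, 0 < mu ∧ b = rhs H A α p mu }
      · exact (csInf_le hbb ⟨1, one_pos, rfl⟩).trans ((hM p hp).trans (le_max_right _ _))
      · rw [Real.sInf_of_not_bddBelow hbb]
        exact le_max_left _ _
    refine le_trans ?_ (le_csSup hbdd ⟨p, hp, hps, rfl⟩)
    refine le_csInf ⟨_, 1, one_pos, rfl⟩ ?_
    rintro b ⟨m, hm, rfl⟩
    exact hb m hm
end MimoAux

/-- If `α < α_th`, then `C_H(A, αA) ≤ sup_p inf_{μ>0} {…}` where the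
supremum is over probability vectors `p` on `𝒰` with `Σ_U p_U s_U ≤ α`. -/
theorem MimoOptical.capacity_upper_bound_avg_one
    (nt nr : ℕ) (hnr : 1 ≤ nr) (hntnr : nr < nt)
    (H : Matrix (Fin nr) (Fin nt) ℝ) (hrank : H.rank = nr)
    (A α : ℝ) (hA : 0 < A) (hα : 0 < α)
    (htie : ∀ U ∈ MimoOptical.goodSets H, ∀ j ∉ U, MimoOptical.aUj H U j ≠ 1)
    (h : α < MimoOptical.alphaTh H) :
    MimoOptical.capacity H A (α * A) ≤
      sSup { c | ∃ p : Finset (Fin nt) → ℝ, MimoOptical.ProbVec H p ∧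
        (∑ᶠ U ∈ MimoOptical.goodSets H, p U * MimoOptical.sU H U) ≤ α ∧
        c = sInf { b | ∃ mu : ℝ, 0 < mu ∧
          b = Real.log (MimoOptical.VH H) - MimoOptical.Dkl H p (MimoOptical.qU H)
            + (∑ᶠ U ∈ MimoOptical.goodSets H, p U *
                ∑ ℓ, Real.log (MimoOptical.sigmaUl H U ℓ
                  + A / Real.sqrt (2 * Real.pi * Real.exp 1)
                    * ((1 - Real.exp (-mu)) / mu)))
            + mu / (A * Real.sqrt (2 * Real.pi)) *
                (∑ᶠ U ∈ MimoOptical.goodSets H, p U *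
                  ∑ ℓ, MimoOptical.sigmaUl H U ℓ *
                    (1 - Real.exp (-(A ^ 2) / (2 * (MimoOptical.sigmaUl H U ℓ) ^ 2))))
            + mu * (α - ∑ᶠ U ∈ MimoOptical.goodSets H, p U * MimoOptical.sU H U) } } := by
  exact MimoAux.final H hrank A α hA hα htie
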